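/- arXiv:1912.07216 — 5 statements merged into one kernel-verified Lean document; each statement's English description precedes it below -/
import Mathlib

section
/- Let L be a λ-graph bisystem over a finite alphabet Σ satisfying FPCC. Then the configuration space X_L, equipped with the topology generated by the cylinder sets, is a compact Hausdorff topological space. -/
/-! ## λ-graph bisystems -/

structure LambdaGraphBisystem (A : Type) where
  V : ℕ → Type
  Em : ℕ → Type
  Ep : ℕ → Type
  fintypeV : ∀ l, Fintype (V l)
  nonemptyV : ∀ l, Nonempty (V l)
  fintypeEm : ∀ l, Fintype (Em l)
  fintypeEp : ∀ l, Fintype (Ep l)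
  sm : ∀ l, Em l → V (l + 1)
  tm : ∀ l, Em l → V l
  lm : ∀ l, Em l → A
  sp : ∀ l, Ep l → V l
  tp : ∀ l, Ep l → V (l + 1)
  lp : ∀ l, Ep l → A

namespace LambdaGraphBisystem

variable {A : Type}

/-- The follower sets `F(v)`: label words of downward paths in `L⁻` starting at `v`,
labels read in reverse edge order. -/
def Fset (L : LambdaGraphBisystem A) : ∀ l, L.V l → Set (List A)
  | 0, _ => {[]}
  | l + 1, v =>
    {w | ∃ e : L.Em l, L.sm l e = v ∧ ∃ w' ∈ L.Fset l (L.tm l e), w = L.lm l e :: w'}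

/-- The predecessor sets `P(v)`: label words of upward paths in `L⁺` ending at `v`. -/
def Pset (L : LambdaGraphBisystem A) : ∀ l, L.V l → Set (List A)
  | 0, _ => {[]}
  | l + 1, v =>
    {w | ∃ e : L.Ep l, L.tp l e = v ∧ ∃ w' ∈ L.Pset l (L.sp l e), w = w' ++ [L.lp l e]}

end LambdaGraphBisystem

/-- The axioms making a pair of labeled Bratteli diagrams a λ-graph bisystem
satisfying FPCC. -/
structure IsLGBS {A : Type} (L : LambdaGraphBisystem A) : Prop where
  subsingletonV0 : Subsingleton (L.V 0)
  rightResolving : ∀ l (e f : L.Em l), L.sm l e = L.sm l f → L.lm l e = L.lm l f → e = f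
  leftResolving : ∀ l (e f : L.Ep l), L.tp l e = L.tp l f → L.lp l e = L.lp l f → e = f
  localProperty : ∀ (l : ℕ) (u : L.V l) (v : L.V (l + 2)),
    ∃ φ : {fp : L.Ep l × L.Em (l + 1) //
            L.sp l fp.1 = u ∧ L.tp l fp.1 = L.tm (l + 1) fp.2 ∧ L.sm (l + 1) fp.2 = v} ≃
          {ee : L.Em l × L.Ep (l + 1) //
            L.tm l ee.1 = u ∧ L.sm l ee.1 = L.sp (l + 1) ee.2 ∧ L.tp (l + 1) ee.2 = v},
      ∀ fp, L.lp l fp.val.1 = L.lp (l + 1) (φ fp).val.2 ∧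
            L.lm (l + 1) fp.val.2 = L.lm l (φ fp).val.1
  fpcc : ∀ l (v : L.V l), L.Fset l v = L.Pset l v

variable {A : Type}

/-! ## The configuration space.

A configuration is indexed here by coordinates `(k, n)` where `k : ℤ` is the row and
`n : ℕ` is the level; the pair `(k, n)` corresponds to the position `(k, l)` of the paper
with `l = k + n + 1` (so `n = n(k,l) = l - k - 1`).  `v k n` is the vertex `v_{(k,l)}`,
`em k n` is the edge `e⁻_{(k-1,k),l} ∈ E⁻_{n(k-1,l),n(k,l)}` and `ep k n` is the edge
`e⁺_{k,(l,l+1)} ∈ E⁺_{n(k,l),n(k,l+1)}`. -/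

structure Config {A : Type} (L : LambdaGraphBisystem A) where
  v : ℤ → ∀ n : ℕ, L.V n
  em : ℤ → ∀ n : ℕ, L.Em n
  ep : ℤ → ∀ n : ℕ, L.Ep n
  em_s : ∀ (k : ℤ) (n : ℕ), L.sm n (em k n) = v (k - 1) (n + 1)
  em_t : ∀ (k : ℤ) (n : ℕ), L.tm n (em k n) = v k n
  ep_s : ∀ (k : ℤ) (n : ℕ), L.sp n (ep k n) = v k n
  ep_t : ∀ (k : ℤ) (n : ℕ), L.tp n (ep k n) = v k (n + 1)
  label : ∃ xs : ℤ → A, (∀ (k : ℤ) (n : ℕ), L.lm n (em k n) = xs k) ∧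
    (∀ (k : ℤ) (n : ℕ), L.lp n (ep k n) = xs (k + n + 1))

theorem Config.v_congr {L : LambdaGraphBisystem A} (x : Config L) {a b : ℤ} (n : ℕ)
    (h : a = b) : x.v a n = x.v b n := by rw [h]

/-- The word `P_x(v_{(p,q)})` of `λ⁺`-labels along row `p`, of length `n = q - p - 1`. -/
def Pword {L : LambdaGraphBisystem A} (x : Config L) (p : ℤ) : ℕ → List A
  | 0 => []
  | n + 1 => Pword x p n ++ [L.lp n (x.ep p n)]

/-- The cylinder set `U_{(μ; v)}` for a vertex `v` at position `(p, p + n + 1)`. -/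
def Cyl {L : LambdaGraphBisystem A} (p : ℤ) (n : ℕ) (v : L.V n) (μ : List A) :
    Set (Config L) :=
  {x | x.v p n = v ∧ Pword x p n = μ}

def cylinderSets (L : LambdaGraphBisystem A) : Set (Set (Config L)) :=
  {U | ∃ (p : ℤ) (n : ℕ) (v : L.V n) (μ : List A), μ ∈ L.Pset n v ∧ U = Cyl p n v μ}

/-- The topology on the configuration space generated by the cylinder sets. -/
def configTop (L : LambdaGraphBisystem A) : TopologicalSpace (Config L) :=
  TopologicalSpace.generateFrom (cylinderSets L)

instance (L : LambdaGraphBisystem A) : TopologicalSpace (Config L) := configTop L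
/-! ## Triangles and the metric -/

/-- Equality of the `(p,q)`-triangles `△_{(p,q)}(x) = △_{(p,q)}(z)`:
the restrictions of the two configurations to `{(k,l) : p ≤ k < l ≤ q}` coincide. -/
def TriEq {L : LambdaGraphBisystem A} (x z : Config L) (p q : ℤ) : Prop :=
  (∀ (k : ℤ) (n : ℕ), p ≤ k → k + n + 1 ≤ q → x.v k n = z.v k n) ∧
  (∀ (k : ℤ) (n : ℕ), p + 1 ≤ k → k + n + 1 ≤ q → x.em k n = z.em k n) ∧
  (∀ (k : ℤ) (n : ℕ), p ≤ k → k + n + 2 ≤ q → x.ep k n = z.ep k n)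

open scoped Classical in
/-- The metric on `X_L` defined from agreement of central triangles:
`d(x,z) ≤ 1/2^p` iff `△_{(-p,p)}(x) = △_{(-p,p)}(z)`. -/
noncomputable def configDist {L : LambdaGraphBisystem A} (x z : Config L) : ℝ :=
  ⨅ p : ℕ, if TriEq x z (-(p : ℤ)) (p : ℤ) then ((1 : ℝ) / 2) ^ p else 1

/-! ## Standalone (p,q)-triangles -/

structure Triangle {A : Type} (L : LambdaGraphBisystem A) (p q : ℤ) where
  v : ∀ (k : ℤ) (n : ℕ), p ≤ k → k + n + 1 ≤ q → L.V n
  em : ∀ (k : ℤ) (n : ℕ), p + 1 ≤ k → k + n + 1 ≤ q → L.Em n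
  ep : ∀ (k : ℤ) (n : ℕ), p ≤ k → k + n + 2 ≤ q → L.Ep n
  em_s : ∀ (k : ℤ) (n : ℕ) (h : p + 1 ≤ k) (h' : k + n + 1 ≤ q),
    L.sm n (em k n h h') = v (k - 1) (n + 1) (by omega) (by omega)
  em_t : ∀ (k : ℤ) (n : ℕ) (h : p + 1 ≤ k) (h' : k + n + 1 ≤ q),
    L.tm n (em k n h h') = v k n (by omega) h'
  ep_s : ∀ (k : ℤ) (n : ℕ) (h : p ≤ k) (h' : k + n + 2 ≤ q),
    L.sp n (ep k n h h') = v k n h (by omega)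
  ep_t : ∀ (k : ℤ) (n : ℕ) (h : p ≤ k) (h' : k + n + 2 ≤ q),
    L.tp n (ep k n h h') = v k (n + 1) h (by omega)
  label : ∃ xs : ℤ → A,
    (∀ (k : ℤ) (n : ℕ) (h : p + 1 ≤ k) (h' : k + n + 1 ≤ q), L.lm n (em k n h h') = xs k) ∧
    (∀ (k : ℤ) (n : ℕ) (h : p ≤ k) (h' : k + n + 2 ≤ q), L.lp n (ep k n h h') = xs (k + n + 1))

/-- The `λ⁺`-label word along the bottom row of a `(p,q)`-triangle. -/
def Triangle.word {L : LambdaGraphBisystem A} {p q : ℤ} (T : Triangle L p q) :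
    ∀ n : ℕ, p + n + 1 ≤ q → List A
  | 0, _ => []
  | n + 1, h => T.word n (by omega) ++ [L.lp n (T.ep p n le_rfl (by omega))]

/-! ## (p,q)-rectangles -/

structure Rect {A : Type} (L : LambdaGraphBisystem A) (p q : ℤ) where
  v : ∀ (k : ℤ) (n : ℕ), k ≤ p → q ≤ k + n + 1 → L.V n
  em : ∀ (k : ℤ) (n : ℕ), k ≤ p → q ≤ k + n + 1 → L.Em n
  ep : ∀ (k : ℤ) (n : ℕ), k ≤ p → q ≤ k + n + 1 → L.Ep n
  em_s : ∀ (k : ℤ) (n : ℕ) (h : k ≤ p) (h' : q ≤ k + n + 1),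
    L.sm n (em k n h h') = v (k - 1) (n + 1) (by omega) (by omega)
  em_t : ∀ (k : ℤ) (n : ℕ) (h : k ≤ p) (h' : q ≤ k + n + 1),
    L.tm n (em k n h h') = v k n h h'
  ep_s : ∀ (k : ℤ) (n : ℕ) (h : k ≤ p) (h' : q ≤ k + n + 1),
    L.sp n (ep k n h h') = v k n h h'
  ep_t : ∀ (k : ℤ) (n : ℕ) (h : k ≤ p) (h' : q ≤ k + n + 1),
    L.tp n (ep k n h h') = v k (n + 1) h (by omega)
  label : ∃ xs : ℤ → A,
    (∀ (k : ℤ) (n : ℕ) (h : k ≤ p) (h' : q ≤ k + n + 1), L.lm n (em k n h h') = xs k) ∧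
    (∀ (k : ℤ) (n : ℕ) (h : k ≤ p) (h' : q ≤ k + n + 1), L.lp n (ep k n h h') = xs (k + n + 1))

theorem Rect.v_congr {L : LambdaGraphBisystem A} {p q : ℤ} (R : Rect L p q) {a b : ℤ}
    (n : ℕ) (h : a = b) {h1 : a ≤ p} {h2 : q ≤ a + n + 1} {h3 : b ≤ p} {h4 : q ≤ b + n + 1} :
    R.v a n h1 h2 = R.v b n h3 h4 := by subst h; rfl

/-- The `(p,q)`-rectangle `□_{(p,q)}(x)` of a configuration `x`. -/
def Config.toRect {L : LambdaGraphBisystem A} (x : Config L) (p q : ℤ) : Rect L p q where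
  v k n _ _ := x.v k n
  em k n _ _ := x.em k n
  ep k n _ _ := x.ep k n
  em_s k n _ _ := x.em_s k n
  em_t k n _ _ := x.em_t k n
  ep_s k n _ _ := x.ep_s k n
  ep_t k n _ _ := x.ep_t k n
  label := by
    obtain ⟨xs, h1, h2⟩ := x.label
    exact ⟨xs, fun k n _ _ => h1 k n, fun k n _ _ => h2 k n⟩

/-- The upper left corner vertex of a `(p,q)`-rectangle. -/
def Rect.corner {L : LambdaGraphBisystem A} {p q : ℤ} (R : Rect L p q) (n₀ : ℕ)
    (hn : (n₀ : ℤ) = q - p - 1) : L.V n₀ :=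
  R.v p n₀ le_rfl (by omega)

/-! ## Zigzag paths -/

/-- A zigzag path starting from a vertex `v ∈ V_{(p,q)}`, `n₀ = n(p,q)`:
`ep k` is `e⁺_{p-k,(q+k,q+k+1)}` and `em k` is `e⁻_{(p-k-1,p-k),q+k+1}`. -/
structure Zigzag {A : Type} (L : LambdaGraphBisystem A) (n₀ : ℕ) (v : L.V n₀) where
  ep : ∀ k : ℕ, L.Ep (n₀ + 2 * k)
  em : ∀ k : ℕ, L.Em (n₀ + 2 * k + 1)
  start : L.sp n₀ (ep 0) = v
  turn1 : ∀ k : ℕ, L.tp (n₀ + 2 * k) (ep k) = L.tm (n₀ + 2 * k + 1) (em k)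
  turn2 : ∀ k : ℕ, L.sm (n₀ + 2 * k + 1) (em k) = L.sp (n₀ + 2 * k + 2) (ep (k + 1))

/-- The vertex `v_{(p-k, q+k)}` visited by a zigzag path. -/
def Zigzag.vert {L : LambdaGraphBisystem A} {n₀ : ℕ} {v : L.V n₀} (γ : Zigzag L n₀ v)
    (k : ℕ) : L.V (n₀ + 2 * k) := L.sp (n₀ + 2 * k) (γ.ep k)

/-- The vertex `v_{(p-k, q+k+1)}` visited by a zigzag path. -/
def Zigzag.vert' {L : LambdaGraphBisystem A} {n₀ : ℕ} {v : L.V n₀} (γ : Zigzag L n₀ v)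
    (k : ℕ) : L.V (n₀ + 2 * k + 1) := L.tp (n₀ + 2 * k) (γ.ep k)

/-- The zigzag path obtained by restricting a `(p,q)`-rectangle. -/
def Rect.toZigzag {L : LambdaGraphBisystem A} {p q : ℤ} (R : Rect L p q) (n₀ : ℕ)
    (hn : (n₀ : ℤ) = q - p - 1) : Zigzag L n₀ (R.corner n₀ hn) where
  ep k := R.ep (p - k) (n₀ + 2 * k) (by omega) (by omega)
  em k := R.em (p - k) (n₀ + 2 * k + 1) (by omega) (by omega)
  start := (R.ep_s _ _ _ _).trans (R.v_congr _ (by simp))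
  turn1 k := (R.ep_t _ _ _ _).trans (R.em_t _ _ _ _).symm
  turn2 k := (R.em_s _ _ _ _).trans
    ((R.v_congr _ (by push_cast; ring)).trans (R.ep_s _ _ _ _).symm)
/-! ## Zigzag paths with head symbol -/

/-- The set `Z_L`: a zigzag path starting from a vertex of `V_1 = V_{(-1,1)}`
together with a head symbol `x₀`. -/
structure ZigzagHead {A : Type} (L : LambdaGraphBisystem A) where
  x0 : A
  v : L.V 1
  γ : Zigzag L 1 v
  head : ∃ e : L.Ep 0, L.lp 0 e = x0 ∧ L.tp 0 e = v

/-- Restriction of a configuration to its zigzag path with head symbol. -/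
def Config.toZigzagHead {L : LambdaGraphBisystem A} (x : Config L) : ZigzagHead L where
  x0 := L.lp 0 (x.ep (-1) 0)
  v := x.v (-1) 1
  γ :=
  { ep := fun k => x.ep (-1 - (k : ℤ)) (1 + 2 * k)
    em := fun k => x.em (-1 - (k : ℤ)) (1 + 2 * k + 1)
    start := (x.ep_s _ _).trans (x.v_congr _ (by simp))
    turn1 := fun k => (x.ep_t _ _).trans (x.em_t _ _).symm
    turn2 := fun k => (x.em_s _ _).trans
      ((x.v_congr _ (by push_cast; ring)).trans (x.ep_s _ _).symm) }
  head := ⟨x.ep (-1) 0, rfl, x.ep_t (-1) 0⟩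

/-- Condition (I): every vertex admits at least two zigzag paths starting from it. -/
def ConditionI (L : LambdaGraphBisystem A) : Prop :=
  ∀ (p q : ℤ), p < q → ∀ v : L.V (q - p - 1).toNat,
    ∃ γ₁ γ₂ : Zigzag L (q - p - 1).toNat v, γ₁ ≠ γ₂

/-! ## The AF-equivalence relation -/

/-- `□_{(p,q)}(x) = □_{(p,q)}(z)` : the restrictions of the two configurations to the
lower right infinite rectangle `{(k,l) : k ≤ p, q ≤ l}` coincide. -/
def RectEq {L : LambdaGraphBisystem A} (x z : Config L) (p q : ℤ) : Prop :=
  ∀ (k : ℤ) (n : ℕ), k ≤ p → q ≤ k + n + 1 →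
    x.v k n = z.v k n ∧ x.em k n = z.em k n ∧ x.ep k n = z.ep k n

/-- The relation `x ∼ z` on `X_L`. -/
def ConfigRel {L : LambdaGraphBisystem A} (x z : Config L) : Prop :=
  ∃ p q : ℤ, p < q ∧ RectEq x z p q

/-- The subequivalence relation `R_{L,(p,q)}` as a subset of `X_L × X_L`. -/
def RpqSet (L : LambdaGraphBisystem A) (p q : ℤ) : Set (Config L × Config L) :=
  {xz | RectEq xz.1 xz.2 p q}

/-- The equivalence relation `R_L` as a subset of `X_L × X_L`. -/
def Rset (L : LambdaGraphBisystem A) : Set (Config L × Config L) :=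
  {xz | ∃ p q : ℤ, p < q ∧ RectEq xz.1 xz.2 p q}

/-- The inclusion `R_{L,(p,q)} → R_L`. -/
def inclPQ (L : LambdaGraphBisystem A) (p q : ℤ) (h : p < q) (y : ↥(RpqSet L p q)) :
    ↥(Rset L) := ⟨y.val, ⟨p, q, h, y.prop⟩⟩

/-- The inductive limit topology on `R_L = ⋃ R_{L,(p,q)}`, where each `R_{L,(p,q)}`
carries the relative topology of `X_L × X_L`. -/
def indTop (L : LambdaGraphBisystem A) : TopologicalSpace ↥(Rset L) :=
  ⨆ (p : ℤ) (q : ℤ) (h : p < q),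
    TopologicalSpace.coinduced (inclPQ L p q h) inferInstance

/-! ## The shift -/

/-- The shift `σ_L^m` on the configuration space, `σ_L^m(x)_{(k,l)} = x_{(k+m,l+m)}`. -/
def shiftBy (L : LambdaGraphBisystem A) (m : ℤ) (x : Config L) : Config L where
  v k n := x.v (k + m) n
  em k n := x.em (k + m) n
  ep k n := x.ep (k + m) n
  em_s k n := (x.em_s (k + m) n).trans (x.v_congr (n + 1) (by ring))
  em_t k n := x.em_t (k + m) n
  ep_s k n := x.ep_s (k + m) n
  ep_t k n := x.ep_t (k + m) n
  label := by
    obtain ⟨xs, h1, h2⟩ := x.label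
    refine ⟨fun k => xs (k + m), fun k n => h1 (k + m) n, fun k n => (h2 (k + m) n).trans ?_⟩
    congr 1
    ring

/-- The label sequence `π(x) = (x_n)_{n ∈ ℤ}` of a configuration. -/
def configSeq {L : LambdaGraphBisystem A} (x : Config L) : ℤ → A :=
  fun k => L.lm 0 (x.em k 0)

/-! ## The groupoid `G_L = R_L ⋊ ℤ` -/

/-- `G_L = {(x,n,z) : (σ_L^n(x), z) ∈ R_L}`. -/
def GLset (L : LambdaGraphBisystem A) : Set (Config L × ℤ × Config L) :=
  {g | (shiftBy L g.2.1 g.1, g.2.2) ∈ Rset L}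

/-- The canonical bijection `(x,n,z) ↦ ((σ_L^n(x), z), n)` of `G_L` with `R_L × ℤ`. -/
def GLmap (L : LambdaGraphBisystem A) (g : ↥(GLset L)) : ↥(Rset L) × ℤ :=
  (⟨(shiftBy L g.val.2.1 g.val.1, g.val.2.2), g.prop⟩, g.val.2.1)

/-- The topology on `G_L` transported from `R_L × ℤ` (with `R_L` carrying the
inductive limit topology). -/
def GLtop (L : LambdaGraphBisystem A) : TopologicalSpace ↥(GLset L) :=
  TopologicalSpace.induced (GLmap L) (@instTopologicalSpaceProd _ _ (indTop L) _)

/-- `(X_L, σ_L)` is equivalently essentially free. -/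
def EquivEssFree (L : LambdaGraphBisystem A) : Prop :=
  ∀ n : ℤ, n ≠ 0 → interior {x : Config L | (shiftBy L n x, x) ∈ Rset L} = ∅

/-! ## Irreducibility -/

/-- Irreducibility of a λ-graph bisystem: every zigzag path `γ` from a vertex of
`V_1 = V_{(-1,1)}` is met by some zigzag path `η` from any prescribed vertex of
`V_{(-p,p)} = V_{2p-1}`; meeting means passing through the same vertex. -/
def IrreducibleLGBS (L : LambdaGraphBisystem A) : Prop :=
  ∀ p : ℕ, 1 ≤ p → ∀ (w : L.V (2 * p - 1)) (v : L.V 1) (γ : Zigzag L 1 v),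
    ∃ η : Zigzag L (2 * p - 1) w, ∃ k j : ℕ, 1 + 2 * k = 2 * p - 1 + 2 * j ∧
      (HEq (γ.vert k) (η.vert j) ∨ HEq (γ.vert' k) (η.vert' j))

theorem Pword_mem_aux {A : Type} {L : LambdaGraphBisystem A} (x : Config L) (p : ℤ) (n : ℕ) :
    Pword x p n ∈ L.Pset n (x.v p n) := by
  induction n with
  | zero => simp [Pword, LambdaGraphBisystem.Pset]
  | succ n ih =>
    refine ⟨x.ep p n, x.ep_t p n, Pword x p n, ?_, rfl⟩
    rw [x.ep_s]; exact ih

theorem Config_ext_aux {A : Type} {L : LambdaGraphBisystem A} (hL : IsLGBS L) (x z : Config L)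
    (hv : ∀ p n, x.v p n = z.v p n) (hP : ∀ p n, Pword x p n = Pword z p n) : x = z := by
  have hlp : ∀ p n, L.lp n (x.ep p n) = L.lp n (z.ep p n) := by
    intro p n
    have h := hP p (n + 1)
    simp only [Pword, hP p n] at h
    simpa using h
  have hep : ∀ p n, x.ep p n = z.ep p n := by
    intro p n
    apply hL.leftResolving n _ _ _ (hlp p n)
    rw [x.ep_t, z.ep_t, hv]
  have hem : ∀ p n, x.em p n = z.em p n := by
    intro p n
    apply hL.rightResolving n
    · rw [x.em_s, z.em_s, hv]
    · obtain ⟨xs, h1, h2⟩ := x.label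
      obtain ⟨zs, h3, h4⟩ := z.label
      rw [h1, h3]
      have := hlp (p - 1) 0
      rw [h2, h4] at this
      simpa using this
  have e1 : x.v = z.v := by funext p n; exact hv p n
  have e2 : x.em = z.em := by funext p n; exact hem p n
  have e3 : x.ep = z.ep := by funext p n; exact hep p n
  cases x; cases z
  simp only at e1 e2 e3
  subst e1 e2 e3
  rfl

theorem Config_t2_aux {A : Type} (L : LambdaGraphBisystem A) (hL : IsLGBS L) :
    T2Space (Config L) := by
  refine ⟨fun x z hxz => ?_⟩
  by_contra hcon
  apply hxz
  have key : ∀ p n, x.v p n = z.v p n ∧ Pword x p n = Pword z p n := by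
    intro p n
    by_contra h
    apply hcon
    refine ⟨Cyl p n (x.v p n) (Pword x p n), Cyl p n (z.v p n) (Pword z p n),
      TopologicalSpace.isOpen_generateFrom_of_mem ⟨p, n, _, _, Pword_mem_aux x p n, rfl⟩,
      TopologicalSpace.isOpen_generateFrom_of_mem ⟨p, n, _, _, Pword_mem_aux z p n, rfl⟩,
      ⟨rfl, rfl⟩, ⟨rfl, rfl⟩, ?_⟩
    rw [Set.disjoint_left]
    rintro y ⟨h1, h2⟩ ⟨h3, h4⟩
    exact h ⟨h1.symm.trans h3, h2.symm.trans h4⟩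
  exact Config_ext_aux hL x z (fun p n => (key p n).1) (fun p n => (key p n).2)

/-- Raw data of a configuration. -/
abbrev RawCfg {A : Type} (L : LambdaGraphBisystem A) : Type :=
  (∀ i : ℤ × ℕ, L.V i.2) × (∀ i : ℤ × ℕ, L.Em i.2) × (∀ i : ℤ × ℕ, L.Ep i.2)

/-- The constraints on raw data, all at once. -/
def RawOK {A : Type} (L : LambdaGraphBisystem A) (i : ℤ × ℕ) : Set (RawCfg L) :=
  {c | L.sm i.2 (c.2.1 i) = c.1 (i.1 - 1, i.2 + 1) ∧ L.tm i.2 (c.2.1 i) = c.1 i ∧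
    L.sp i.2 (c.2.2 i) = c.1 i ∧ L.tp i.2 (c.2.2 i) = c.1 (i.1, i.2 + 1) ∧
    L.lm i.2 (c.2.1 i) = L.lm 0 (c.2.1 (i.1, 0)) ∧
    L.lp i.2 (c.2.2 i) = L.lm 0 (c.2.1 (i.1 + i.2 + 1, 0))}

def rawToConfig {A : Type} (L : LambdaGraphBisystem A)
    (c : {c : RawCfg L // ∀ i, c ∈ RawOK L i}) : Config L where
  v k n := c.1.1 (k, n)
  em k n := c.1.2.1 (k, n)
  ep k n := c.1.2.2 (k, n)
  em_s k n := (c.2 (k, n)).1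
  em_t k n := (c.2 (k, n)).2.1
  ep_s k n := (c.2 (k, n)).2.2.1
  ep_t k n := (c.2 (k, n)).2.2.2.1
  label := ⟨fun k => L.lm 0 (c.1.2.1 (k, 0)), fun k n => (c.2 (k, n)).2.2.2.2.1,
    fun k n => (c.2 (k, n)).2.2.2.2.2⟩

theorem rawToConfig_surj {A : Type} (L : LambdaGraphBisystem A) :
    Function.Surjective (rawToConfig L) := by
  intro x
  obtain ⟨xs, h1, h2⟩ := x.label
  refine ⟨⟨(fun i => x.v i.1 i.2, fun i => x.em i.1 i.2, fun i => x.ep i.1 i.2), fun i =>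
    ⟨x.em_s _ _, x.em_t _ _, x.ep_s _ _, x.ep_t _ _, ?_, ?_⟩⟩, rfl⟩
  · exact (h1 _ _).trans (h1 _ _).symm
  · exact (h2 _ _).trans (h1 _ _).symm

theorem lc_of_cont_aux {X Y Z : Type} [TopologicalSpace X] [TopologicalSpace Y]
    [DiscreteTopology Y] {f : X → Y} (hf : Continuous f) (g : Y → Z) :
    IsLocallyConstant (fun x => g (f x)) :=
  ((IsLocallyConstant.iff_continuous f).2 hf).comp g

theorem lc_eq_clopen_aux {X Z : Type} [TopologicalSpace X] {f g : X → Z}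
    (hf : IsLocallyConstant f) (hg : IsLocallyConstant g) : IsClosed {x | f x = g x} := by
  have h := (hf.prodMk hg).isClopen_fiber
  have h2 := (hf.prodMk hg) {p | p.1 ≠ p.2}
  rw [← isOpen_compl_iff]
  exact h2

theorem Config_compact_aux {A : Type} (L : LambdaGraphBisystem A) :
    CompactSpace (Config L) := by
  letI : ∀ n, TopologicalSpace (L.V n) := fun n => ⊥
  letI : ∀ n, TopologicalSpace (L.Em n) := fun n => ⊥
  letI : ∀ n, TopologicalSpace (L.Ep n) := fun n => ⊥
  haveI : ∀ n, DiscreteTopology (L.V n) := fun n => ⟨rfl⟩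
  haveI : ∀ n, DiscreteTopology (L.Em n) := fun n => ⟨rfl⟩
  haveI : ∀ n, DiscreteTopology (L.Ep n) := fun n => ⟨rfl⟩
  haveI : ∀ n, Finite (L.V n) := fun n => @Finite.of_fintype _ (L.fintypeV n)
  haveI : ∀ n, Finite (L.Em n) := fun n => @Finite.of_fintype _ (L.fintypeEm n)
  haveI : ∀ n, Finite (L.Ep n) := fun n => @Finite.of_fintype _ (L.fintypeEp n)
  have cv : ∀ i : ℤ × ℕ, Continuous (fun c : RawCfg L => c.1 i) := fun i => by fun_prop
  have cm : ∀ i : ℤ × ℕ, Continuous (fun c : RawCfg L => c.2.1 i) := fun i => by fun_prop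
  have cp : ∀ i : ℤ × ℕ, Continuous (fun c : RawCfg L => c.2.2 i) := fun i => by fun_prop
  have hclosed : IsClosed {c : RawCfg L | ∀ i, c ∈ RawOK L i} := by
    rw [Set.setOf_forall]
    refine isClosed_iInter fun i => ?_
    refine IsClosed.inter (lc_eq_clopen_aux (lc_of_cont_aux (cm i) _) (lc_of_cont_aux (cv _) id)) ?_
    refine IsClosed.inter (lc_eq_clopen_aux (lc_of_cont_aux (cm i) _) (lc_of_cont_aux (cv _) id)) ?_
    refine IsClosed.inter (lc_eq_clopen_aux (lc_of_cont_aux (cp i) _) (lc_of_cont_aux (cv _) id)) ?_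
    refine IsClosed.inter (lc_eq_clopen_aux (lc_of_cont_aux (cp i) _) (lc_of_cont_aux (cv _) id)) ?_
    refine IsClosed.inter (lc_eq_clopen_aux (lc_of_cont_aux (cm i) _) (lc_of_cont_aux (cm _) _)) ?_
    exact lc_eq_clopen_aux (lc_of_cont_aux (cp i) _) (lc_of_cont_aux (cm _) _)
  haveI : CompactSpace {c : RawCfg L // ∀ i, c ∈ RawOK L i} :=
    isCompact_iff_compactSpace.1 hclosed.isCompact
  refine (rawToConfig_surj L).compactSpace (f := rawToConfig L) ?_
  refine continuous_generateFrom_iff.2 ?_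
  rintro U ⟨p, n, v, μ, -, rfl⟩
  have lv : IsLocallyConstant (fun c => (rawToConfig L c).v p n) :=
    lc_of_cont_aux ((cv (p, n)).comp continuous_subtype_val) id
  have lP : IsLocallyConstant (fun c => Pword (rawToConfig L c) p n) := by
    clear lv
    induction n with
    | zero => exact IsLocallyConstant.const []
    | succ n ih =>
      exact (ih (L.nonemptyV n).some).comp₂
        (lc_of_cont_aux ((cp (p, n)).comp continuous_subtype_val) (L.lp n)) (fun w a => w ++ [a])
  exact (lv {v}).inter (lP {μ})

/-- For a λ-graph bisystem `L` over a finite alphabet satisfying FPCC, the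
configuration space `X_L` with the topology generated by the cylinder sets is a compact
Hausdorff topological space. -/
theorem configuration_space_compactHausdorff {A : Type} [Fintype A]
    (L : LambdaGraphBisystem A) (hL : IsLGBS L) :
    CompactSpace (Config L) ∧ T2Space (Config L) := by
  exact ⟨Config_compact_aux L, Config_t2_aux L hL⟩
end

section
/- Let L be a λ-graph bisystem over a finite alphabet Σ satisfying FPCC. The cylinder sets form an open neighborhood basis of X_L: whenever a configuration x belongs to U_{(μ;v)} ∩ U_{(μ';v')} for cylinder sets attached to vertices v ∈ V_{(p,q)} and v' ∈ V_{(p',q')}, then, setting p₀ = min{p,p'} and q₀ = max{q,q'}, one has x ∈ U_{(ν;w)} ⊆ U_{(μ;v)} ∩ U_{(μ';v')}, where w = x_{(p₀,q₀)} and ν = P_x(w). -/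
variable {A : Type}

theorem Pword_eq_iff {L : LambdaGraphBisystem A} (x z : Config L) (xs zs : ℤ → A)
    (hx : ∀ (k : ℤ) (n : ℕ), L.lp n (x.ep k n) = xs (k + n + 1))
    (hz : ∀ (k : ℤ) (n : ℕ), L.lp n (z.ep k n) = zs (k + n + 1)) (p : ℤ) (n : ℕ) :
    Pword x p n = Pword z p n ↔ ∀ j : ℤ, p < j → j ≤ p + n → xs j = zs j := by
  induction n with
  | zero =>
    refine ⟨fun _ j h1 h2 => ?_, fun _ => rfl⟩
    push_cast at h2
    omega
  | succ n ih =>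
    simp only [Pword]
    rw [List.append_eq_append_iff_of_size_eq_right (by simp), ih, hx, hz]
    constructor
    · rintro ⟨h1, h2⟩ j hj hj'
      rcases eq_or_ne j (p + n + 1) with rfl | hne
      · simpa using h2
      · exact h1 j hj (by push_cast at hj'; omega)
    · intro h
      refine ⟨fun j h1 h2 => h j h1 (by push_cast; omega), ?_⟩
      rw [h _ (by omega) (by push_cast; omega)]

theorem v_agree_left {L : LambdaGraphBisystem A} (hL : IsLGBS L) (x z : Config L)
    (xs zs : ℤ → A)
    (hx : ∀ (k : ℤ) (n : ℕ), L.lp n (x.ep k n) = xs (k + n + 1))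
    (hz : ∀ (k : ℤ) (n : ℕ), L.lp n (z.ep k n) = zs (k + n + 1)) (p : ℤ) (n d : ℕ)
    (hv : x.v p (n + d) = z.v p (n + d))
    (h : ∀ j : ℤ, p < j → j ≤ p + (n + d : ℕ) → xs j = zs j) : x.v p n = z.v p n := by
  induction d with
  | zero => exact hv
  | succ d ih =>
    apply ih
    · have : x.ep p (n + d) = z.ep p (n + d) := by
        apply hL.leftResolving
        · rw [x.ep_t, z.ep_t]; exact hv
        · rw [hx, hz]; exact h _ (by omega) (by push_cast; omega)
      rw [← x.ep_s, ← z.ep_s, this]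
    · exact fun j h1 h2 => h j h1 (by push_cast at h2 ⊢; omega)

theorem v_agree_up {L : LambdaGraphBisystem A} (hL : IsLGBS L) (x z : Config L)
    (xs zs : ℤ → A)
    (hx : ∀ (k : ℤ) (n : ℕ), L.lm n (x.em k n) = xs k)
    (hz : ∀ (k : ℤ) (n : ℕ), L.lm n (z.em k n) = zs k) (p : ℤ) (n d : ℕ)
    (hv : x.v (p - d) (n + d) = z.v (p - d) (n + d))
    (h : ∀ j : ℤ, p - d < j → j ≤ p + n → xs j = zs j) : x.v p n = z.v p n := by
  induction d with
  | zero => simpa using hv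
  | succ d ih =>
    apply ih
    · have : x.em (p - d) (n + d) = z.em (p - d) (n + d) := by
        apply hL.rightResolving
        · rw [x.em_s, z.em_s]
          have e : p - d - 1 = p - (d + 1 : ℕ) := by push_cast; ring
          rw [e]; exact hv
        · rw [hx, hz]; exact h _ (by push_cast; omega) (by omega)
      rw [← x.em_t, ← z.em_t, this]
    · exact fun j h1 h2 => h j (by push_cast; omega) h2

theorem cyl_agree {L : LambdaGraphBisystem A} (hL : IsLGBS L) (x z : Config L)
    (p₀ p : ℤ) (n₀ n : ℕ) (hp : p₀ ≤ p) (hn : p + n ≤ p₀ + n₀)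
    (hv : z.v p₀ n₀ = x.v p₀ n₀) (hw : Pword z p₀ n₀ = Pword x p₀ n₀) :
    z.v p n = x.v p n ∧ Pword z p n = Pword x p n := by
  obtain ⟨xs, hx1, hx2⟩ := x.label
  obtain ⟨zs, hz1, hz2⟩ := z.label
  rw [Pword_eq_iff z x zs xs hz2 hx2] at hw ⊢
  refine ⟨?_, fun j h1 h2 => hw j (by omega) (by omega)⟩
  obtain ⟨d, hd⟩ : ∃ d : ℕ, p = p₀ + d := ⟨(p - p₀).toNat, by omega⟩
  obtain ⟨e, rfl⟩ : ∃ e : ℕ, n₀ = (n + d) + e := ⟨n₀ - (n + d), by omega⟩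
  apply v_agree_up hL z x zs xs hz1 hx1 p n d
  · have : p - d = p₀ := by omega
    rw [this]
    exact v_agree_left hL z x zs xs hz2 hx2 p₀ (n + d) e hv hw
  · exact fun j h1 h2 => hw j (by omega) (by push_cast; omega)

theorem Pword_mem {L : LambdaGraphBisystem A} (x : Config L) (p : ℤ) (n : ℕ) :
    Pword x p n ∈ L.Pset n (x.v p n) := by
  induction n with
  | zero => exact rfl
  | succ n ih =>
    exact ⟨x.ep p n, x.ep_t p n, Pword x p n, by rw [x.ep_s]; exact ih, rfl⟩

theorem cyl_sub {L : LambdaGraphBisystem A} (hL : IsLGBS L)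
    (p : ℤ) (n : ℕ) (v : L.V n) (μ : List A)
    (p' : ℤ) (n' : ℕ) (v' : L.V n') (μ' : List A)
    (x : Config L) (hx : x ∈ Cyl p n v μ ∩ Cyl p' n' v' μ')
    (n₀ : ℕ) (hn₀ : (n₀ : ℤ) = max (p + n + 1) (p' + n' + 1) - min p p' - 1) :
    Cyl (min p p') n₀ (x.v (min p p') n₀) (Pword x (min p p') n₀) ⊆
      Cyl p n v μ ∩ Cyl p' n' v' μ' := by
  rintro z ⟨hv, hw⟩
  obtain ⟨⟨rfl, rfl⟩, ⟨rfl, rfl⟩⟩ := hx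
  exact ⟨cyl_agree hL x z _ p n₀ n (by omega) (by omega) hv hw,
    cyl_agree hL x z _ p' n₀ n' (by omega) (by omega) hv hw⟩

/-- The cylinder sets form an open neighborhood basis of `X_L`; whenever
`x ∈ U_{(μ;v)} ∩ U_{(μ';v')}` for cylinders at positions `(p, q = p+n+1)` and
`(p', q' = p'+n'+1)`, then with `p₀ = min p p'`, `q₀ = max q q'`, `w = x_{(p₀,q₀)}` and
`ν = P_x(w)` one has `x ∈ U_{(ν;w)} ⊆ U_{(μ;v)} ∩ U_{(μ';v')}`. -/
theorem cylinder_sets_form_basis {A : Type} [Fintype A]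
    (L : LambdaGraphBisystem A) (hL : IsLGBS L)
    (p : ℤ) (n : ℕ) (v : L.V n) (μ : List A) (hμ : μ ∈ L.Pset n v)
    (p' : ℤ) (n' : ℕ) (v' : L.V n') (μ' : List A) (hμ' : μ' ∈ L.Pset n' v')
    (x : Config L) (hx : x ∈ Cyl p n v μ ∩ Cyl p' n' v' μ')
    (n₀ : ℕ) (hn₀ : (n₀ : ℤ) = max (p + n + 1) (p' + n' + 1) - min p p' - 1) :
    TopologicalSpace.IsTopologicalBasis (cylinderSets L) ∧
    Pword x (min p p') n₀ ∈ L.Pset n₀ (x.v (min p p') n₀) ∧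
    x ∈ Cyl (min p p') n₀ (x.v (min p p') n₀) (Pword x (min p p') n₀) ∧
    Cyl (min p p') n₀ (x.v (min p p') n₀) (Pword x (min p p') n₀) ⊆
      Cyl p n v μ ∩ Cyl p' n' v' μ' := by
  refine ⟨⟨?_, ?_, rfl⟩, Pword_mem x _ _, ⟨rfl, rfl⟩,
    cyl_sub hL p n v μ p' n' v' μ' x hx n₀ hn₀⟩
  · rintro _ ⟨p, n, v, μ, -, rfl⟩ _ ⟨p', n', v', μ', -, rfl⟩ x hx
    refine ⟨_, ⟨min p p', (max (p + n + 1) (p' + n' + 1) - min p p' - 1).toNat, _, _,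
      Pword_mem x _ _, rfl⟩, ⟨rfl, rfl⟩, cyl_sub hL p n v μ p' n' v' μ' x hx _ (by omega)⟩
  · refine Set.eq_univ_of_forall fun x => ?_
    exact ⟨_, ⟨0, 0, _, _, Pword_mem x 0 0, rfl⟩, rfl, rfl⟩
end

section
/- Let L be a λ-graph bisystem over a finite alphabet Σ satisfying FPCC. Take (p,q) ∈ ℤ² with p < q and a vertex v ∈ V_{(p,q)}. For every (p,q)-rectangle □ whose vertex at position (p,q) is v and every word μ ∈ P(v), there exists a unique configuration x ∈ X_L such that □_{(p,q)}(x) = □ and P_x(v) = μ. -/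
variable {A : Type}

/-! ## Helpers -/

def WW {A : Type} (xs : ℤ → A) (k : ℤ) (n : ℕ) : List A :=
  (List.range n).map (fun i : ℕ => xs (k + i + 1))

theorem WW_succ {A : Type} (xs : ℤ → A) (k : ℤ) (n : ℕ) :
    WW xs k (n + 1) = WW xs k n ++ [xs (k + n + 1)] := by
  simp [WW, List.range_succ]

theorem WW_cons {A : Type} (xs : ℤ → A) (k : ℤ) (n : ℕ) :
    WW xs k (n + 1) = xs (k + 1) :: WW xs (k + 1) n := by
  simp only [WW, List.range_succ_eq_map, List.map_cons, List.map_map]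
  congr 1
  · simp
  · apply List.map_congr_left
    intro i _
    simp only [Function.comp]
    congr 1
    push_cast
    ring

theorem Pset_length {A : Type} (L : LambdaGraphBisystem A) :
    ∀ (n : ℕ) (v : L.V n) (w : List A), w ∈ L.Pset n v → w.length = n
  | 0, v, w, h => by
    have h' : w = [] := h
    simp [h']
  | n + 1, v, w, h => by
    obtain ⟨e, _, w', hw', rfl⟩ := h
    simp [Pset_length L n _ w' hw']

theorem Pword_eq {A : Type} {L : LambdaGraphBisystem A} (x : Config L) (xs : ℤ → A)
    (h : ∀ (k : ℤ) (n : ℕ), L.lp n (x.ep k n) = xs (k + n + 1)) (p : ℤ) :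
    ∀ n, Pword x p n = WW xs p n
  | 0 => by simp [Pword, WW]
  | n + 1 => by rw [Pword, WW_succ, Pword_eq x xs h p n, h]

def IsEp {A : Type} (L : LambdaGraphBisystem A) (n : ℕ) (u : L.V n) (v : L.V (n + 1)) (a : A) :
    Prop := ∃ e : L.Ep n, L.sp n e = u ∧ L.tp n e = v ∧ L.lp n e = a

def IsEm {A : Type} (L : LambdaGraphBisystem A) (n : ℕ) (v : L.V (n + 1)) (u : L.V n) (a : A) :
    Prop := ∃ e : L.Em n, L.sm n e = v ∧ L.tm n e = u ∧ L.lm n e = a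

/-- from below-right to above-left -/
theorem IsLGBS.loc1 {A : Type} {L : LambdaGraphBisystem A} (hL : IsLGBS L) {n : ℕ}
    {u : L.V n} {v : L.V (n + 2)} {w w' : L.V (n + 1)} {a b : A}
    (h1 : IsEp L n u w b) (h2 : IsEm L (n + 1) v w a) (h3 : IsEp L (n + 1) w' v b) :
    IsEm L n w' u a := by
  obtain ⟨f, f1, f2, f3⟩ := h1
  obtain ⟨e, e1, e2, e3⟩ := h2
  obtain ⟨g, g1, g2, g3⟩ := h3
  obtain ⟨φ, hφ⟩ := hL.localProperty n u v
  have hh := hφ ⟨(f, e), f1, by rw [f2, e2], e1⟩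
  generalize φ ⟨(f, e), f1, by rw [f2, e2], e1⟩ = z at hh
  obtain ⟨⟨e', g'⟩, z1, z2, z3⟩ := z
  simp only at hh z1 z2 z3
  have : g' = g := hL.leftResolving _ _ _ (z3.trans g2.symm) (by rw [← hh.1, f3, g3])
  subst this
  exact ⟨e', z2.trans g1, z1, hh.2.symm.trans e3⟩

theorem IsLGBS.loc2 {A : Type} {L : LambdaGraphBisystem A} (hL : IsLGBS L) {n : ℕ}
    {u : L.V n} {v : L.V (n + 2)} {w w' : L.V (n + 1)} {a b : A}
    (h1 : IsEm L n w u a) (h2 : IsEp L (n + 1) w v b) (h3 : IsEm L (n + 1) v w' a) :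
    IsEp L n u w' b := by
  obtain ⟨f, f1, f2, f3⟩ := h1
  obtain ⟨e, e1, e2, e3⟩ := h2
  obtain ⟨g, g1, g2, g3⟩ := h3
  obtain ⟨φ, hφ⟩ := hL.localProperty n u v
  obtain ⟨⟨⟨f', g'⟩, z1, z2, z3⟩, hz⟩ := φ.surjective ⟨(f, e), f2, by rw [f1, e1], e2⟩
  have hh := hφ ⟨(f', g'), z1, z2, z3⟩
  rw [hz] at hh
  simp only at hh z1 z2 z3
  have : g' = g := hL.rightResolving _ _ _ (z3.trans g1.symm) (by rw [hh.2, f3, g3])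
  subst this
  exact ⟨f', z1, z2.trans g2, hh.1.trans e3⟩

theorem row_word {A : Type} {L : LambdaGraphBisystem A} (xs : ℤ → A) (k : ℤ)
    (v : ∀ n, L.V n) (hv : ∀ n : ℕ, IsEp L n (v n) (v (n + 1)) (xs (k + n + 1))) :
    ∀ n, WW xs k n ∈ L.Pset n (v n)
  | 0 => by simp [WW, LambdaGraphBisystem.Pset]
  | n + 1 => by
    obtain ⟨e, e1, e2, e3⟩ := hv n
    refine ⟨e, e2, WW xs k n, ?_, ?_⟩
    · rw [e1]; exact row_word xs k v hv n
    · rw [WW_succ, e3]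

theorem next_row {A : Type} {L : LambdaGraphBisystem A} (hL : IsLGBS L) (xs : ℤ → A) (k : ℤ)
    (v : ∀ n, L.V n) (hv : ∀ n : ℕ, IsEp L n (v n) (v (n + 1)) (xs (k + n + 1))) :
    ∃ v' : ∀ n, L.V n, (∀ n : ℕ, IsEp L n (v' n) (v' (n + 1)) (xs (k + 1 + n + 1))) ∧
      ∀ n : ℕ, IsEm L n (v (n + 1)) (v' n) (xs (k + 1)) := by
  have h1 : ∀ n : ℕ, ∃ u : L.V n, IsEm L n (v (n + 1)) u (xs (k + 1)) := by
    intro n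
    have := row_word xs k v hv (n + 1)
    rw [← hL.fpcc, WW_cons] at this
    obtain ⟨e, e1, w, hw, e2⟩ := this
    simp only [List.cons.injEq] at e2
    exact ⟨L.tm n e, e, e1, rfl, e2.1.symm⟩
  choose v' hv' using h1
  refine ⟨v', fun n => ?_, hv'⟩
  have h2 := hv (n + 1)
  have : k + 1 + (n : ℤ) + 1 = k + ((n + 1 : ℕ) : ℤ) + 1 := by push_cast; ring
  rw [this]
  exact hL.loc2 (hv' n) h2 (hv' (n + 1))

theorem fill_row {A : Type} {L : LambdaGraphBisystem A} (xs : ℤ → A) (k : ℤ) :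
    ∀ (N : ℕ) (v : ∀ n, L.V n),
      (∀ n : ℕ, N ≤ n → IsEp L n (v n) (v (n + 1)) (xs (k + n + 1))) →
      WW xs k N ∈ L.Pset N (v N) →
      ∃ v' : ∀ n, L.V n, (∀ n, N ≤ n → v' n = v n) ∧
        ∀ n : ℕ, IsEp L n (v' n) (v' (n + 1)) (xs (k + n + 1))
  | 0, v, h, _ => ⟨v, fun _ _ => rfl, fun n => h n (Nat.zero_le _)⟩
  | N + 1, v, h, hw => by
    obtain ⟨e, e1, w, hw, e2⟩ := hw
    rw [WW_succ] at e2
    obtain ⟨e3, e4⟩ := List.append_inj' e2 rfl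
    simp only [List.cons.injEq, and_true] at e4
    have key : ∀ n, N + 1 ≤ n → Function.update v N (L.sp N e) n = v n := by
      intro n hn
      rw [Function.update_of_ne (by omega)]
    obtain ⟨v', h1, h2⟩ := fill_row xs k N (Function.update v N (L.sp N e)) (by
      intro n hn
      rcases Nat.eq_or_lt_of_le hn with rfl | hn
      · rw [key _ le_rfl, Function.update_self]
        exact ⟨e, rfl, e1, e4.symm⟩
      · rw [key _ hn, key _ (by omega)]
        exact h n hn) (by rw [Function.update_self, e3]; exact hw)
    exact ⟨v', fun n hn => (h1 n (by omega)).trans (key n hn), h2⟩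

theorem rect_word {A : Type} {L : LambdaGraphBisystem A} {p q : ℤ} (R : Rect L p q)
    (xs : ℤ → A)
    (h1 : ∀ (k : ℤ) (n : ℕ) (h : k ≤ p) (h' : q ≤ k + n + 1), L.lm n (R.em k n h h') = xs k)
    (n : ℕ) (hn : (n : ℤ) = q - p - 1) (hw : WW xs p n ∈ L.Fset n (R.corner n hn)) :
    ∀ (j : ℕ) (k : ℤ) (N : ℕ) (h : k ≤ p) (h' : q ≤ k + N + 1), k = p - j → k + N + 1 = q →
      WW xs k N ∈ L.Fset N (R.v k N h h')
  | 0, k, N, h, h', hk, hN => by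
    obtain rfl : k = p := by omega
    obtain rfl : N = n := by omega
    exact hw
  | j + 1, k, N, h, h', hk, hN => by
    obtain ⟨M, rfl⟩ : ∃ M, N = M + 1 := ⟨N - 1, by omega⟩
    have ih := rect_word R xs h1 n hn hw j (k + 1) M (by omega) (by omega) (by omega)
      (by push_cast at hN; omega)
    refine ⟨R.em (k + 1) M (by omega) (by omega), ?_, WW xs (k + 1) M, ?_, ?_⟩
    · exact (R.em_s _ _ _ _).trans (R.v_congr _ (by ring))
    · rw [R.em_t]; exact ih
    · rw [h1, WW_cons]

theorem config_ext_of {A : Type} {L : LambdaGraphBisystem A} (hL : IsLGBS L) (p q : ℤ)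
    (x z : Config L) (xs : ℤ → A)
    (x1 : ∀ (k : ℤ) (n : ℕ), L.lm n (x.em k n) = xs k)
    (x2 : ∀ (k : ℤ) (n : ℕ), L.lp n (x.ep k n) = xs (k + n + 1))
    (z1 : ∀ (k : ℤ) (n : ℕ), L.lm n (z.em k n) = xs k)
    (z2 : ∀ (k : ℤ) (n : ℕ), L.lp n (z.ep k n) = xs (k + n + 1))
    (h : ∀ (k : ℤ) (n : ℕ), k ≤ p → q ≤ k + n + 1 → x.v k n = z.v k n) : x = z := by
  have low : ∀ k ≤ p, ∀ n, x.v k n = z.v k n := by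
    intro k hk
    have : ∀ j n : ℕ, q ≤ k + (n + j : ℕ) + 1 → x.v k n = z.v k n := by
      intro j
      induction j with
      | zero => intro n hn; exact h k n hk (by simpa using hn)
      | succ j ih =>
        intro n hn
        have := ih (n + 1) (by push_cast at hn ⊢; omega)
        rw [← x.ep_t, ← z.ep_t] at this
        have := hL.leftResolving _ _ _ this (by rw [x2, z2])
        rw [← x.ep_s, ← z.ep_s, this]
    intro n
    exact this (q - k).toNat n (by push_cast; omega)
  have hv : ∀ k n, x.v k n = z.v k n := by
    have : ∀ (j : ℕ) (k : ℤ), k ≤ p + j → ∀ n, x.v k n = z.v k n := by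
      intro j
      induction j with
      | zero => intro k hk; exact low k (by simpa using hk)
      | succ j ih =>
        intro k hk n
        have := ih (k - 1) (by push_cast at hk; omega) (n + 1)
        rw [← x.em_s, ← z.em_s] at this
        have := hL.rightResolving _ _ _ this (by rw [x1, z1])
        rw [← x.em_t, ← z.em_t, this]
    intro k
    exact this (k - p).toNat k (by omega)
  have hem : ∀ k n, x.em k n = z.em k n := fun k n =>
    hL.rightResolving _ _ _ (by rw [x.em_s, z.em_s, hv]) (by rw [x1, z1])
  have hep : ∀ k n, x.ep k n = z.ep k n := fun k n =>
    hL.leftResolving _ _ _ (by rw [x.ep_t, z.ep_t, hv]) (by rw [x2, z2])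
  obtain ⟨xv, xem, xep, _, _, _, _, _⟩ := x
  obtain ⟨zv, zem, zep, _, _, _, _, _⟩ := z
  obtain rfl : xv = zv := funext fun k => funext fun n => hv k n
  obtain rfl : xem = zem := funext fun k => funext fun n => hem k n
  obtain rfl : xep = zep := funext fun k => funext fun n => hep k n
  rfl

theorem rect_ext_of {A : Type} {L : LambdaGraphBisystem A} {p q : ℤ} (x z : Rect L p q)
    (hv : ∀ k n h h', x.v k n h h' = z.v k n h h')
    (hem : ∀ k n h h', x.em k n h h' = z.em k n h h')
    (hep : ∀ k n h h', x.ep k n h h' = z.ep k n h h') : x = z := by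
  obtain ⟨xv, xem, xep, _, _, _, _, _⟩ := x
  obtain ⟨zv, zem, zep, _, _, _, _, _⟩ := z
  obtain rfl : xv = zv := by funext k n h h'; exact hv k n h h'
  obtain rfl : xem = zem := by funext k n h h'; exact hem k n h h'
  obtain rfl : xep = zep := by funext k n h h'; exact hep k n h h'
  rfl

/-- Any two label sequences agree. -/
theorem labels_agree {A : Type} {L : LambdaGraphBisystem A} (p q : ℤ) (n : ℕ)
    (hn : (n : ℤ) = q - p - 1) (x z : Config L) (xs zs : ℤ → A)
    (x1 : ∀ (k : ℤ) (n : ℕ), L.lm n (x.em k n) = xs k)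
    (x2 : ∀ (k : ℤ) (n : ℕ), L.lp n (x.ep k n) = xs (k + n + 1))
    (z1 : ∀ (k : ℤ) (n : ℕ), L.lm n (z.em k n) = zs k)
    (z2 : ∀ (k : ℤ) (n : ℕ), L.lp n (z.ep k n) = zs (k + n + 1))
    (hR : x.toRect p q = z.toRect p q) (hP : Pword x p n = Pword z p n) : xs = zs := by
  have hem : ∀ (k : ℤ) (n : ℕ) (_ : k ≤ p) (_ : q ≤ k + n + 1), x.em k n = z.em k n := by
    intro k n h h'
    have : (x.toRect p q).em k n h h' = (z.toRect p q).em k n h h' := by rw [hR]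
    exact this
  have hep : ∀ (k : ℤ) (n : ℕ) (_ : k ≤ p) (_ : q ≤ k + n + 1), x.ep k n = z.ep k n := by
    intro k n h h'
    have : (x.toRect p q).ep k n h h' = (z.toRect p q).ep k n h h' := by rw [hR]
    exact this
  funext k
  rcases le_or_gt k p with hk | hk
  · rw [← x1 k (q - k).toNat, ← z1 k (q - k).toNat, hem _ _ hk (by omega)]
  rcases le_or_gt q k with hk' | hk'
  · have := hep p (k - p - 1).toNat le_rfl (by omega)
    have h1 := x2 p (k - p - 1).toNat
    have h2 := z2 p (k - p - 1).toNat
    have h3 : p + ((k - p - 1).toNat : ℤ) + 1 = k := by omega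
    rw [h3] at h1 h2
    rw [← h1, ← h2, this]
  · rw [Pword_eq x xs x2, Pword_eq z zs z2] at hP
    unfold WW at hP
    have := List.map_inj_left.1 hP (k - p - 1).toNat (by simp; omega)
    have h3 : p + ((k - p - 1).toNat : ℤ) + 1 = k := by omega
    rwa [h3] at this

theorem vertex_family {A : Type} {L : LambdaGraphBisystem A} (hL : IsLGBS L)
    {p q : ℤ} (n : ℕ) (hn : (n : ℤ) = q - p - 1) (R : Rect L p q) (xs : ℤ → A)
    (h1 : ∀ (k : ℤ) (n : ℕ) (h : k ≤ p) (h' : q ≤ k + n + 1), L.lm n (R.em k n h h') = xs k)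
    (h2 : ∀ (k : ℤ) (n : ℕ) (h : k ≤ p) (h' : q ≤ k + n + 1),
      L.lp n (R.ep k n h h') = xs (k + n + 1))
    (hw : WW xs p n ∈ L.Pset n (R.corner n hn)) :
    ∃ v : ℤ → ∀ n, L.V n,
      (∀ k n h h', v k n = R.v k n h h') ∧
      (∀ (k : ℤ) (n : ℕ), IsEp L n (v k n) (v k (n + 1)) (xs (k + n + 1))) ∧
      (∀ (k : ℤ) (n : ℕ), IsEm L n (v (k - 1) (n + 1)) (v k n) (xs k)) := by
  classical
  have hlow : ∀ k : ℤ, ∃ v : ∀ n, L.V n, k ≤ p →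
      ((∀ n h h', v n = R.v k n h h') ∧
        ∀ n : ℕ, IsEp L n (v n) (v (n + 1)) (xs (k + n + 1))) := by
    intro k
    by_cases hk : k ≤ p
    · let v0 : ∀ n, L.V n := fun n =>
        if h : q ≤ k + n + 1 then R.v k n hk h else (L.nonemptyV n).some
      have hv0 : ∀ (n : ℕ) (h : q ≤ k + n + 1), v0 n = R.v k n hk h := fun n h => dif_pos h
      obtain ⟨N, hN⟩ : ∃ N : ℕ, k + N + 1 = q := ⟨(q - k - 1).toNat, by omega⟩
      obtain ⟨v, e1, e2⟩ := fill_row (L := L) xs k N v0 (by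
        intro m hm
        rw [hv0 m (by omega), hv0 (m + 1) (by push_cast; omega)]
        exact ⟨R.ep k m hk (by omega), R.ep_s _ _ _ _, R.ep_t _ _ _ _, h2 _ _ _ _⟩) (by
        rw [hv0 N (by omega), ← hL.fpcc]
        exact rect_word R xs h1 n hn (by rw [hL.fpcc]; exact hw) (p - k).toNat k N hk _
          (by omega) hN)
      exact ⟨v, fun _ => ⟨fun m h h' => (e1 m (by omega)).trans (hv0 m h'), e2⟩⟩
    · exact ⟨fun n => (L.nonemptyV n).some, fun h => absurd h hk⟩
  choose low hlow using hlow
  let S : ℕ → Type := fun j =>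
    {v : ∀ n, L.V n // ∀ n : ℕ, IsEp L n (v n) (v (n + 1)) (xs (p + j + n + 1))}
  have step : ∀ j (s : S j), ∃ t : S (j + 1),
      ∀ n : ℕ, IsEm L n (s.1 (n + 1)) (t.1 n) (xs (p + j + 1)) := by
    intro j s
    obtain ⟨v', a, b⟩ := next_row hL xs (p + j) s.1 s.2
    refine ⟨⟨v', fun n => ?_⟩, b⟩
    have := a n
    push_cast
    rwa [add_assoc p (j : ℤ) 1] at this
  choose nx hnx using step
  let up : ∀ j, S j := fun j => Nat.rec
    (⟨low p, by simpa using (hlow p le_rfl).2⟩ : S 0) (fun j s => nx j s) j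
  have up0 : (up 0).1 = low p := rfl
  have upS : ∀ j (n : ℕ), IsEm L n ((up j).1 (n + 1)) ((up (j + 1)).1 n) (xs (p + j + 1)) :=
    fun j => hnx j (up j)
  let v : ℤ → ∀ n, L.V n := fun k => if k ≤ p then low k else (up (k - p).toNat).1
  have vlow : ∀ k, k ≤ p → v k = low k := fun k h => if_pos h
  have vup : ∀ j : ℕ, v (p + j) = (up j).1 := by
    intro j
    rcases Nat.eq_zero_or_pos j with rfl | hj
    · rw [vlow _ (by simp), up0]; simp
    · have : ¬ (p + (j : ℤ) ≤ p) := by omega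
      have e : (p + (j : ℤ) - p).toNat = j := by omega
      have gen : ∀ i, i = j → (up i).1 = (up j).1 := by rintro i rfl; rfl
      exact (if_neg this).trans (gen _ e)
  have hEp : ∀ (k : ℤ) (n : ℕ), IsEp L n (v k n) (v k (n + 1)) (xs (k + n + 1)) := by
    intro k m
    rcases le_or_gt k p with hk | hk
    · rw [vlow k hk]; exact (hlow k hk).2 m
    · obtain ⟨j, rfl⟩ : ∃ j : ℕ, k = p + j := ⟨(k - p).toNat, by omega⟩
      rw [vup]; exact (up j).2 m
  have hR : ∀ k n h h', v k n = R.v k n h h' := by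
    intro k m h h'
    rw [vlow k h]; exact (hlow k h).1 m h h'
  refine ⟨v, hR, hEp, ?_⟩
  intro k m
  rcases le_or_gt k p with hk | hk
  · have : ∀ j m : ℕ, q ≤ k + (m + j : ℕ) + 1 →
        IsEm L m (v (k - 1) (m + 1)) (v k m) (xs k) := by
      intro j
      induction j with
      | zero =>
        intro m hm
        simp only [Nat.add_zero] at hm
        rw [hR k m hk hm, hR (k - 1) (m + 1) (by omega) (by push_cast; omega)]
        exact ⟨R.em k m hk hm, R.em_s _ _ _ _, R.em_t _ _ _ _, h1 _ _ _ _⟩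
      | succ j ih =>
        intro m hm
        have i1 := ih (m + 1) (by push_cast at hm ⊢; omega)
        have i2 := hEp (k - 1) (m + 1)
        have e : k - 1 + ((m + 1 : ℕ) : ℤ) + 1 = k + m + 1 := by push_cast; ring
        rw [e] at i2
        exact hL.loc1 (hEp k m) i1 i2
    exact this (q - k).toNat m (by push_cast; omega)
  · obtain ⟨j, rfl⟩ : ∃ j : ℕ, k = p + (j + 1 : ℕ) := ⟨(k - p - 1).toNat, by omega⟩
    have e : p + ((j + 1 : ℕ) : ℤ) - 1 = p + j := by push_cast; ring
    rw [e, vup, vup]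
    have := upS j m
    rwa [add_assoc] at this

/-- For every `(p,q)`-rectangle `□` whose vertex at position `(p,q)` is `v`
and every word `μ ∈ P(v)` there is a unique configuration `x ∈ X_L` with
`□_{(p,q)}(x) = □` and `P_x(v) = μ`. -/
theorem rectangle_word_unique_extension {A : Type} [Fintype A]
    (L : LambdaGraphBisystem A) (hL : IsLGBS L)
    (p q : ℤ) (n : ℕ) (hn : (n : ℤ) = q - p - 1) (v : L.V n)
    (R : Rect L p q) (hv : R.corner n hn = v)
    (μ : List A) (hμ : μ ∈ L.Pset n v) :
    ∃! x : Config L, Config.toRect x p q = R ∧ Pword x p n = μ := by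
  subst hv
  obtain ⟨rs, r1, r2⟩ := R.label
  have hlen := Pset_length L n _ μ hμ
  obtain ⟨xs, hxs⟩ : ∃ xs : ℤ → A, xs = fun k =>
    if k ≤ p then rs k else μ.getD (k - p - 1).toNat (rs k) := ⟨_, rfl⟩
  have hx1 : ∀ k, k ≤ p → xs k = rs k := by
    intro k hk; rw [hxs]; exact if_pos hk
  have hx2 : ∀ k, q ≤ k → xs k = rs k := by
    intro k hk
    have : ¬ k ≤ p := by omega
    simp only [hxs, if_neg this]
    exact List.getD_eq_default _ _ (by omega)
  have hx3 : WW xs p n = μ := by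
    apply List.ext_getElem
    · simp [WW, hlen]
    · intro i h h'
      have e0 : ¬ (p + (i : ℤ) + 1 ≤ p) := by omega
      have e : (p + (i : ℤ) + 1 - p - 1).toNat = i := by omega
      simp only [WW, List.getElem_map, List.getElem_range, hxs, if_neg e0, e]
      exact List.getD_eq_getElem _ _ h'
  have r1' : ∀ (k : ℤ) (n : ℕ) (h : k ≤ p) (h' : q ≤ k + n + 1),
      L.lm n (R.em k n h h') = xs k := fun k n h h' => by rw [r1, hx1 k h]
  have r2' : ∀ (k : ℤ) (n : ℕ) (h : k ≤ p) (h' : q ≤ k + n + 1),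
      L.lp n (R.ep k n h h') = xs (k + n + 1) := fun k n h h' => by rw [r2, hx2 _ h']
  obtain ⟨v, hR, hEp, hEm⟩ := vertex_family hL n hn R xs r1' r2' (by rw [hx3]; exact hμ)
  choose ep ep1 ep2 ep3 using hEp
  choose em em1 em2 em3 using hEm
  let x : Config L := ⟨v, em, ep, em1, em2, ep1, ep2, xs, em3, ep3⟩
  have hxR : x.toRect p q = R := by
    apply rect_ext_of
    · exact hR
    · intro k m h h'
      refine hL.rightResolving _ _ _ ?_ ?_
      · rw [R.em_s]; exact (em1 k m).trans (hR _ _ _ _)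
      · rw [r1']; exact em3 k m
    · intro k m h h'
      refine hL.leftResolving _ _ _ ?_ ?_
      · rw [R.ep_t]; exact (ep2 k m).trans (hR _ _ _ _)
      · rw [r2']; exact ep3 k m
  have hxP : Pword x p n = μ := by rw [Pword_eq x xs ep3, hx3]
  refine ⟨x, ⟨hxR, hxP⟩, ?_⟩
  rintro z ⟨hzR, hzP⟩
  obtain ⟨zs, z1, z2⟩ := z.label
  obtain rfl : zs = xs := labels_agree p q n hn z x zs xs z1 z2 em3 ep3
    (hzR.trans hxR.symm) (hzP.trans hxP.symm)
  refine config_ext_of hL p q z x zs z1 z2 em3 ep3 ?_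
  intro k m h h'
  have : (z.toRect p q).v k m h h' = (x.toRect p q).v k m h h' := by rw [hzR, hxR]
  exact this
end

section
/- Let L be a λ-graph bisystem over a finite alphabet Σ satisfying FPCC. For each vertex v ∈ V_{(p,q)}, every zigzag path starting from v extends in a unique way to a (p,q)-rectangle whose vertex at position (p,q) is v; this extension gives a bijective correspondence between the set Z(v) of zigzag paths starting from v and the set of (p,q)-rectangles whose upper left corner is v. -/
variable {A : Type}

/-! ## Abstract grids -/

structure GridOK {W M P B : Type} (sm tm : M → W) (sp tp : P → W) (lm : M → B) (lp : P → B)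
    (em : ℕ → ℕ → M) (ep : ℕ → ℕ → P) : Prop where
  em_s : ∀ i j, sm (em i j) = sp (ep (i + 1) j)
  em_t : ∀ i j, tm (em i j) = sp (ep i j)
  ep_t : ∀ i j, tp (ep i j) = sp (ep i (j + 1))
  lab_m : ∀ i j, lm (em i j) = lm (em i (j + 1))
  lab_p : ∀ i j, lp (ep i j) = lp (ep (i + 1) j)

theorem gridOK_unique {W M P B : Type} {sm tm : M → W} {sp tp : P → W} {lm : M → B} {lp : P → B}
    (hr : ∀ e f, sm e = sm f → lm e = lm f → e = f)
    (hl : ∀ e f, tp e = tp f → lp e = lp f → e = f)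
    {em em' : ℕ → ℕ → M} {ep ep' : ℕ → ℕ → P}
    (G : GridOK sm tm sp tp lm lp em ep) (G' : GridOK sm tm sp tp lm lp em' ep')
    (h1 : ∀ k, ep k k = ep' k k) (h2 : ∀ k, em k (k + 1) = em' k (k + 1)) :
    (∀ i j, em i j = em' i j) ∧ (∀ i j, ep i j = ep' i j) := by
  have low : ∀ d, (∀ k, ep (k + d) k = ep' (k + d) k) ∧
      (∀ k, em (k + d) (k + 1) = em' (k + d) (k + 1)) := by
    intro d
    induction d with
    | zero => exact ⟨h1, h2⟩
    | succ d ih =>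
      obtain ⟨i1, i2⟩ := ih
      have a : ∀ k, ep (k + (d + 1)) k = ep' (k + (d + 1)) k := by
        intro k
        apply hl
        · rw [G.ep_t, G'.ep_t, ← add_assoc, ← G.em_s, ← G'.em_s, i2]
        · rw [← add_assoc, ← G.lab_p, ← G'.lab_p, i1]
      refine ⟨a, fun k => ?_⟩
      have e : k + (d + 1) = (k + 1) + d := by omega
      rw [e]
      apply hr
      · have := a (k + 1)
        rw [← add_assoc] at this
        rw [G.em_s, G'.em_s, this]
      · rw [G.lab_m, G'.lab_m, i2]
  have up : ∀ d, (∀ k, ep k (k + d) = ep' k (k + d)) ∧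
      (∀ k, em k (k + d + 1) = em' k (k + d + 1)) := by
    intro d
    induction d with
    | zero => exact ⟨h1, h2⟩
    | succ d ih =>
      obtain ⟨i1, i2⟩ := ih
      have i1' : ∀ k, ep (k + 1) (k + d + 1) = ep' (k + 1) (k + d + 1) := by
        intro k
        have := i1 (k + 1)
        rwa [show k + 1 + d = k + d + 1 by omega] at this
      have a : ∀ k, em k (k + (d + 1) + 1) = em' k (k + (d + 1) + 1) := by
        intro k
        apply hr
        · rw [G.em_s, G'.em_s, ← G.ep_t, ← G'.ep_t, ← add_assoc, i1']
        · rw [← G.lab_m, ← G'.lab_m, ← add_assoc, i2]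
      refine ⟨fun k => ?_, a⟩
      apply hl
      · rw [G.ep_t, G'.ep_t, ← G.em_t, ← G'.em_t, a]
      · rw [G.lab_p, G'.lab_p, ← add_assoc, i1']
  have hp : ∀ i j, ep i j = ep' i j := by
    intro i j
    rcases le_total j i with h | h
    · obtain ⟨d, rfl⟩ := Nat.exists_eq_add_of_le h
      exact (low d).1 j
    · obtain ⟨d, rfl⟩ := Nat.exists_eq_add_of_le h
      exact (up d).1 i
  refine ⟨?_, hp⟩
  have hm : ∀ i j, em i (j + 1) = em' i (j + 1) := by
    intro i j
    rcases le_total j i with h | h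
    · obtain ⟨d, rfl⟩ := Nat.exists_eq_add_of_le h
      exact (low d).2 j
    · obtain ⟨d, rfl⟩ := Nat.exists_eq_add_of_le h
      exact (up d).2 i
  intro i j
  apply hr
  · rw [G.em_s, G'.em_s, hp]
  · rw [G.lab_m, G'.lab_m, hm]

def lowZ {M P : Type} (z : ℕ → P × M) (lg : P → M → M) (lh : P → M → P) : ℕ → ℕ → P × M
  | 0, k => z k
  | d + 1, k => (lh (lowZ z lg lh d k).1 (lowZ z lg lh d k).2,
      lg (lowZ z lg lh d (k + 1)).1 (lowZ z lg lh d (k + 1)).2)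

def upZ {M P : Type} (z : ℕ → P × M) (ue : M → P → P) (uf : M → P → M) : ℕ → ℕ → P × M
  | 0, k => z k
  | d + 1, k => (ue (upZ z ue uf d k).2 (upZ z ue uf d (k + 1)).1,
      uf (upZ z ue uf d k).2 (upZ z ue uf d (k + 1)).1)

theorem gridOK_exists {W M P B : Type} {sm tm : M → W} {sp tp : P → W} {lm : M → B} {lp : P → B}
    (low : ∀ e f, tp e = tm f → ∃ g h, tm g = sp e ∧ sm g = sp h ∧ tp h = sm f ∧
      lp h = lp e ∧ lm g = lm f)
    (up : ∀ g h, sm g = sp h → ∃ e f, sp e = tm g ∧ tp e = tm f ∧ sm f = tp h ∧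
      lp e = lp h ∧ lm f = lm g)
    (z : ℕ → P × M) (z1 : ∀ k, tp (z k).1 = tm (z k).2)
    (z2 : ∀ k, sm (z k).2 = sp (z (k + 1)).1) :
    ∃ em ep, GridOK sm tm sp tp lm lp em ep ∧ (∀ k, ep k k = (z k).1) ∧
      (∀ k, em k (k + 1) = (z k).2) := by
  have low' : ∀ e f, ∃ g h, tp e = tm f → tm g = sp e ∧ sm g = sp h ∧ tp h = sm f ∧
      lp h = lp e ∧ lm g = lm f := by
    intro e f
    by_cases c : tp e = tm f
    · obtain ⟨g, h, r⟩ := low e f c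
      exact ⟨g, h, fun _ => r⟩
    · exact ⟨f, e, fun c' => absurd c' c⟩
  have up' : ∀ g h, ∃ e f, sm g = sp h → sp e = tm g ∧ tp e = tm f ∧ sm f = tp h ∧
      lp e = lp h ∧ lm f = lm g := by
    intro g h
    by_cases c : sm g = sp h
    · obtain ⟨e, f, r⟩ := up g h c
      exact ⟨e, f, fun _ => r⟩
    · exact ⟨h, g, fun c' => absurd c' c⟩
  choose lg lh hlow using low'
  choose ue uf hup using up'
  set D := lowZ z lg lh with hD
  set U := upZ z ue uf with hU
  have D0 : ∀ k, D 0 k = z k := fun k => rfl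
  have U0 : ∀ k, U 0 k = z k := fun k => rfl
  have D1 : ∀ d k, (D (d + 1) k).1 = lh (D d k).1 (D d k).2 := fun _ _ => rfl
  have D2 : ∀ d k, (D (d + 1) k).2 = lg (D d (k + 1)).1 (D d (k + 1)).2 := fun _ _ => rfl
  have U1 : ∀ d k, (U (d + 1) k).1 = ue (U d k).2 (U d (k + 1)).1 := fun _ _ => rfl
  have U2 : ∀ d k, (U (d + 1) k).2 = uf (U d k).2 (U d (k + 1)).1 := fun _ _ => rfl
  clear_value D U
  have ID : ∀ d, (∀ k, tp (D d k).1 = tm (D d k).2) ∧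
      (∀ k, sm (D d k).2 = sp (D d (k + 1)).1) := by
    intro d
    induction d with
    | zero => exact ⟨by simpa [D0] using z1, by simpa [D0] using z2⟩
    | succ d ih =>
      have H := fun k => hlow _ _ (ih.1 k)
      refine ⟨fun k => ?_, fun k => ?_⟩
      · rw [D1, D2, (H _).2.2.1, (H _).1, ih.2]
      · rw [D1, D2, (H _).2.1]
  have IU : ∀ d, (∀ k, tp (U d k).1 = tm (U d k).2) ∧
      (∀ k, sm (U d k).2 = sp (U d (k + 1)).1) := by
    intro d
    induction d with
    | zero => exact ⟨by simpa [U0] using z1, by simpa [U0] using z2⟩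
    | succ d ih =>
      have H := fun k => hup _ _ (ih.2 k)
      refine ⟨fun k => ?_, fun k => ?_⟩
      · rw [U1, U2, (H _).2.1]
      · rw [U1, U2, (H _).2.2.1, (H _).1, ih.1]
  have HD := fun d k => hlow _ _ ((ID d).1 k)
  have HU := fun d k => hup _ _ ((IU d).2 k)
  obtain ⟨ep, hep⟩ : ∃ ep : ℕ → ℕ → P, ep = fun i j =>
    if j ≤ i then (D (i - j) j).1 else (U (j - i) i).1 := ⟨_, rfl⟩
  obtain ⟨em, hem⟩ : ∃ em : ℕ → ℕ → M, em = fun i j =>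
    if j ≤ i then lg (D (i - j) j).1 (D (i - j) j).2 else (U (j - i - 1) i).2 := ⟨_, rfl⟩
  have epL : ∀ d j, ep (j + d) j = (D d j).1 := by intro d j; simp [hep]
  have epU : ∀ d i, ep i (i + d) = (U d i).1 := by
    intro d i
    rcases d with _ | d
    · simp [hep, D0, U0]
    · simp [hep]
  have emL : ∀ d j, em (j + d) j = lg (D d j).1 (D d j).2 := by intro d j; simp [hem]
  have emU : ∀ d i, em i (i + d + 1) = (U d i).2 := by
    intro d i
    simp [hem, add_assoc, show ¬ (i + (d + 1) ≤ i) by omega]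
  have emL' : ∀ d j, em (j + d) (j + 1) = (D d j).2 := by
    intro d j
    rcases d with _ | d
    · have := emU 0 j
      simpa [D0, U0] using this
    · rw [D2, ← emL]; congr 1; omega
  have epL1 : ∀ d j, ep (j + d + 1) j = (D (d + 1) j).1 := fun d j => epL (d + 1) j
  have epL' : ∀ d j, ep (j + d + 1) (j + 1) = (D d (j + 1)).1 := by
    intro d j; rw [← epL]; congr 1; omega
  have epU1 : ∀ d i, ep i (i + d + 1) = (U (d + 1) i).1 := fun d j => epU (d + 1) j
  have epU' : ∀ d i, ep (i + 1) (i + d + 1) = (U d (i + 1)).1 := by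
    intro d i; rw [← epU]; congr 1; omega
  have emU1 : ∀ d i, em i (i + d + 1 + 1) = (U (d + 1) i).2 := fun d j => emU (d + 1) j
  have cs : ∀ i j : ℕ, (∃ d, i = j + d) ∨ (∃ d, j = i + d + 1) := by
    intro i j
    rcases le_or_gt j i with h | h
    · exact Or.inl ⟨i - j, by omega⟩
    · exact Or.inr ⟨j - i - 1, by omega⟩
  refine ⟨em, ep, ⟨?_, ?_, ?_, ?_, ?_⟩, ?_, ?_⟩
  · intro i j
    rcases cs i j with ⟨d, rfl⟩ | ⟨d, rfl⟩
    · rw [emL, epL1, D1, (HD _ _).2.1]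
    · rw [emU, epU', (IU d).2]
  · intro i j
    rcases cs i j with ⟨d, rfl⟩ | ⟨d, rfl⟩
    · rw [emL, epL, (HD _ _).1]
    · rw [emU, epU1, U1, (HU _ _).1]
  · intro i j
    rcases cs i j with ⟨d, rfl⟩ | ⟨d, rfl⟩
    · rcases d with _ | d
      · have := epU 1 j
        rw [add_zero, this, U1, (HU _ _).1, U0, ← z1]
        have := epL 0 j
        rw [add_zero] at this
        rw [this, D0]
      · rw [epL, ← add_assoc, epL', D1, (HD _ _).2.2.1, (ID d).2]
    · rw [epU1]
      have := epU1 (d + 1) i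
      rw [← add_assoc] at this
      rw [this, U1 (d + 1), (HU _ _).1, (IU _).1]
  · intro i j
    rcases cs i j with ⟨d, rfl⟩ | ⟨d, rfl⟩
    · rw [emL, emL', (HD _ _).2.2.2.2]
    · rw [emU, emU1, U2, (HU _ _).2.2.2.2]
  · intro i j
    rcases cs i j with ⟨d, rfl⟩ | ⟨d, rfl⟩
    · rw [epL, epL1, D1, (HD _ _).2.2.2.1]
    · rw [epU1, epU', U1, (HU _ _).2.2.2.1]
  · intro k
    have := epL 0 k
    simpa [D0] using this
  · intro k
    have := emU 0 k
    simpa [U0] using this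

/-! ## Total spaces -/

namespace LambdaGraphBisystem

def SM (L : LambdaGraphBisystem A) (e : Σ n, L.Em n) : Σ n, L.V n := ⟨e.1 + 1, L.sm e.1 e.2⟩
def TM (L : LambdaGraphBisystem A) (e : Σ n, L.Em n) : Σ n, L.V n := ⟨e.1, L.tm e.1 e.2⟩
def LM (L : LambdaGraphBisystem A) (e : Σ n, L.Em n) : A := L.lm e.1 e.2
def SP (L : LambdaGraphBisystem A) (e : Σ n, L.Ep n) : Σ n, L.V n := ⟨e.1, L.sp e.1 e.2⟩
def TP (L : LambdaGraphBisystem A) (e : Σ n, L.Ep n) : Σ n, L.V n := ⟨e.1 + 1, L.tp e.1 e.2⟩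
def LP (L : LambdaGraphBisystem A) (e : Σ n, L.Ep n) : A := L.lp e.1 e.2

end LambdaGraphBisystem

theorem sig_inj {F : ℕ → Type} {n : ℕ} {a b : F n}
    (h : (⟨n, a⟩ : Σ n, F n) = ⟨n, b⟩) : a = b := eq_of_heq (Sigma.mk.inj h).2

theorem total_right {L : LambdaGraphBisystem A} (hL : IsLGBS L) (e f : Σ n, L.Em n)
    (h1 : L.SM e = L.SM f) (h2 : L.LM e = L.LM f) : e = f := by
  obtain ⟨n, e⟩ := e
  obtain ⟨m, f⟩ := f
  have : n = m := by
    have := congrArg Sigma.fst h1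
    simpa [LambdaGraphBisystem.SM] using this
  subst this
  rw [hL.rightResolving n e f (sig_inj h1) h2]

theorem total_left {L : LambdaGraphBisystem A} (hL : IsLGBS L) (e f : Σ n, L.Ep n)
    (h1 : L.TP e = L.TP f) (h2 : L.LP e = L.LP f) : e = f := by
  obtain ⟨n, e⟩ := e
  obtain ⟨m, f⟩ := f
  have : n = m := by
    have := congrArg Sigma.fst h1
    simpa [LambdaGraphBisystem.TP] using this
  subst this
  rw [hL.leftResolving n e f (sig_inj h1) h2]

theorem total_low {L : LambdaGraphBisystem A} (hL : IsLGBS L) (e : Σ n, L.Ep n) (f : Σ n, L.Em n)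
    (h : L.TP e = L.TM f) : ∃ g h, L.TM g = L.SP e ∧ L.SM g = L.SP h ∧ L.TP h = L.SM f ∧
      L.LP h = L.LP e ∧ L.LM g = L.LM f := by
  obtain ⟨n, e⟩ := e
  obtain ⟨m, f⟩ := f
  have : n + 1 = m := congrArg Sigma.fst h
  subst this
  obtain ⟨φ, hφ⟩ := hL.localProperty n (L.sp n e) (L.sm (n + 1) f)
  have hφ := hφ ⟨(e, f), rfl, sig_inj h, rfl⟩
  generalize φ ⟨(e, f), rfl, sig_inj h, rfl⟩ = y at hφ
  obtain ⟨⟨g, h⟩, a, b, c⟩ := y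
  exact ⟨⟨n, g⟩, ⟨n + 1, h⟩, congrArg (Sigma.mk n) a, congrArg (Sigma.mk (n + 1)) b,
    congrArg (Sigma.mk (n + 2)) c, hφ.1.symm, hφ.2.symm⟩

theorem total_up {L : LambdaGraphBisystem A} (hL : IsLGBS L) (g : Σ n, L.Em n) (h : Σ n, L.Ep n)
    (hh : L.SM g = L.SP h) : ∃ e f, L.SP e = L.TM g ∧ L.TP e = L.TM f ∧ L.SM f = L.TP h ∧
      L.LP e = L.LP h ∧ L.LM f = L.LM g := by
  obtain ⟨n, g⟩ := g
  obtain ⟨m, h⟩ := h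
  have : n + 1 = m := congrArg Sigma.fst hh
  subst this
  obtain ⟨φ, hφ⟩ := hL.localProperty n (L.tm n g) (L.tp (n + 1) h)
  have hφ := hφ (φ.symm ⟨(g, h), rfl, sig_inj hh, rfl⟩)
  rw [φ.apply_symm_apply] at hφ
  generalize φ.symm ⟨(g, h), rfl, sig_inj hh, rfl⟩ = y at hφ
  obtain ⟨⟨e, f⟩, a, b, c⟩ := y
  exact ⟨⟨n, e⟩, ⟨n + 1, f⟩, congrArg (Sigma.mk n) a, congrArg (Sigma.mk (n + 1)) b,
    congrArg (Sigma.mk (n + 2)) c, hφ.1, hφ.2⟩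

/-! ## Rectangles versus grids -/

def Rect.gem {L : LambdaGraphBisystem A} {p q : ℤ} (R : Rect L p q) (n₀ : ℕ)
    (hn : (n₀ : ℤ) = q - p - 1) (i j : ℕ) : Σ n, L.Em n :=
  ⟨n₀ + i + j, R.em (p - i) (n₀ + i + j) (by omega) (by omega)⟩

def Rect.gep {L : LambdaGraphBisystem A} {p q : ℤ} (R : Rect L p q) (n₀ : ℕ)
    (hn : (n₀ : ℤ) = q - p - 1) (i j : ℕ) : Σ n, L.Ep n :=
  ⟨n₀ + i + j, R.ep (p - i) (n₀ + i + j) (by omega) (by omega)⟩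

theorem Rect.vsig {L : LambdaGraphBisystem A} {p q : ℤ} (R : Rect L p q) {a b : ℤ} {n m : ℕ}
    (h : a = b) (h' : n = m) {h1 : a ≤ p} {h2 : q ≤ a + n + 1} {h3 : b ≤ p}
    {h4 : q ≤ b + m + 1} :
    (⟨n, R.v a n h1 h2⟩ : Σ n, L.V n) = ⟨m, R.v b m h3 h4⟩ := by
  subst h; subst h'; rfl

theorem Rect.emsig {L : LambdaGraphBisystem A} {p q : ℤ} (R : Rect L p q) {a b : ℤ} {n m : ℕ}
    (h : a = b) (h' : n = m) {h1 : a ≤ p} {h2 : q ≤ a + n + 1} {h3 : b ≤ p}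
    {h4 : q ≤ b + m + 1} :
    (⟨n, R.em a n h1 h2⟩ : Σ n, L.Em n) = ⟨m, R.em b m h3 h4⟩ := by
  subst h; subst h'; rfl

theorem Rect.epsig {L : LambdaGraphBisystem A} {p q : ℤ} (R : Rect L p q) {a b : ℤ} {n m : ℕ}
    (h : a = b) (h' : n = m) {h1 : a ≤ p} {h2 : q ≤ a + n + 1} {h3 : b ≤ p}
    {h4 : q ≤ b + m + 1} :
    (⟨n, R.ep a n h1 h2⟩ : Σ n, L.Ep n) = ⟨m, R.ep b m h3 h4⟩ := by
  subst h; subst h'; rfl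

theorem Rect.gridOK {L : LambdaGraphBisystem A} {p q : ℤ} (R : Rect L p q) (n₀ : ℕ)
    (hn : (n₀ : ℤ) = q - p - 1) :
    GridOK L.SM L.TM L.SP L.TP L.LM L.LP (R.gem n₀ hn) (R.gep n₀ hn) := by
  obtain ⟨xs, x1, x2⟩ := R.label
  refine ⟨fun i j => ?_, fun i j => ?_, fun i j => ?_, fun i j => ?_, fun i j => ?_⟩
  · simp only [Rect.gem, Rect.gep, LambdaGraphBisystem.SM, LambdaGraphBisystem.SP]
    rw [R.em_s, R.ep_s]
    exact R.vsig (by push_cast; ring) (by omega)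
  · simp only [Rect.gem, Rect.gep, LambdaGraphBisystem.TM, LambdaGraphBisystem.SP]
    rw [R.em_t, R.ep_s]
  · simp only [Rect.gep, LambdaGraphBisystem.TP, LambdaGraphBisystem.SP]
    rw [R.ep_t, R.ep_s]
    exact R.vsig rfl (by omega)
  · simp only [Rect.gem, LambdaGraphBisystem.LM]
    rw [x1, x1]
  · simp only [Rect.gep, LambdaGraphBisystem.LP]
    rw [x2, x2]
    congr 1; push_cast; ring

theorem Rect.ext_of_grid {L : LambdaGraphBisystem A} {p q : ℤ} (R S : Rect L p q) (n₀ : ℕ)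
    (hn : (n₀ : ℤ) = q - p - 1) (h1 : ∀ i j, R.gem n₀ hn i j = S.gem n₀ hn i j)
    (h2 : ∀ i j, R.gep n₀ hn i j = S.gep n₀ hn i j) : R = S := by
  have cs : ∀ (k : ℤ) (n : ℕ), k ≤ p → q ≤ k + n + 1 →
      ∃ i j : ℕ, k = p - i ∧ n = n₀ + i + j := fun k n a b =>
    ⟨(p - k).toNat, (k + n + 1 - q).toNat, by omega, by omega⟩
  have e1 : R.em = S.em := by
    funext k n a b
    obtain ⟨i, j, rfl, rfl⟩ := cs k n a b
    exact sig_inj (h1 i j)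
  have e2 : R.ep = S.ep := by
    funext k n a b
    obtain ⟨i, j, rfl, rfl⟩ := cs k n a b
    exact sig_inj (h2 i j)
  have e3 : R.v = S.v := by
    funext k n a b
    rw [← R.ep_s, ← S.ep_s, e2]
  obtain ⟨v, em, ep, _, _, _, _, _⟩ := R
  obtain ⟨v', em', ep', _, _, _, _, _⟩ := S
  simp only at e1 e2 e3
  subst e1 e2 e3
  rfl

def sigGet {F : ℕ → Type} (x : Σ n, F n) (n : ℕ) (h : x.1 = n) : F n := h ▸ x.2

theorem sigGet_eq {F : ℕ → Type} (x : Σ n, F n) (n : ℕ) (h : x.1 = n) :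
    (⟨n, sigGet x n h⟩ : Σ n, F n) = x := by
  subst h; rfl

theorem Rect.exists_of_grid {L : LambdaGraphBisystem A} {p q : ℤ} (n₀ : ℕ)
    (hn : (n₀ : ℤ) = q - p - 1) (em : ℕ → ℕ → Σ n, L.Em n) (ep : ℕ → ℕ → Σ n, L.Ep n)
    (G : GridOK L.SM L.TM L.SP L.TP L.LM L.LP em ep) (h0 : (ep 0 0).1 = n₀) :
    ∃ R : Rect L p q, R.gem n₀ hn = em ∧ R.gep n₀ hn = ep := by
  have l1 : ∀ i j, (em i j).1 = (ep i j).1 := fun i j => congrArg Sigma.fst (G.em_t i j)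
  have l2 : ∀ i j, (em i j).1 + 1 = (ep (i + 1) j).1 := fun i j => congrArg Sigma.fst (G.em_s i j)
  have l3 : ∀ i j, (ep i j).1 + 1 = (ep i (j + 1)).1 := fun i j => congrArg Sigma.fst (G.ep_t i j)
  have lp : ∀ i j, (ep i j).1 = n₀ + i + j := by
    intro i j
    induction j with
    | zero =>
      induction i with
      | zero => exact h0
      | succ i ih => have := l1 i 0; have := l2 i 0; omega
    | succ j ih => have := l3 i j; omega
  have lm : ∀ i j, (em i j).1 = n₀ + i + j := fun i j => (l1 i j).trans (lp i j)
  have am : ∀ i j, L.LM (em i j) = L.LM (em i 0) := by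
    intro i j
    induction j with
    | zero => rfl
    | succ j ih => rw [← G.lab_m, ih]
  have ap : ∀ i j, L.LP (ep i j) = L.LP (ep 0 j) := by
    intro i j
    induction i with
    | zero => rfl
    | succ i ih => rw [← G.lab_p, ih]
  have tm : ∀ {n : ℕ} (x : Σ n, L.Em n) (h : x.1 = n),
      (⟨n, L.tm n (sigGet x n h)⟩ : Σ n, L.V n) = L.TM x := by
    intro n x h; subst h; rfl
  have sm : ∀ {n : ℕ} (x : Σ n, L.Em n) (h : x.1 = n),
      (⟨n + 1, L.sm n (sigGet x n h)⟩ : Σ n, L.V n) = L.SM x := by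
    intro n x h; subst h; rfl
  have sp : ∀ {n : ℕ} (x : Σ n, L.Ep n) (h : x.1 = n),
      (⟨n, L.sp n (sigGet x n h)⟩ : Σ n, L.V n) = L.SP x := by
    intro n x h; subst h; rfl
  have tp : ∀ {n : ℕ} (x : Σ n, L.Ep n) (h : x.1 = n),
      (⟨n + 1, L.tp n (sigGet x n h)⟩ : Σ n, L.V n) = L.TP x := by
    intro n x h; subst h; rfl
  have lam : ∀ {n : ℕ} (x : Σ n, L.Em n) (h : x.1 = n),
      L.lm n (sigGet x n h) = L.LM x := by
    intro n x h; subst h; rfl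
  have lap : ∀ {n : ℕ} (x : Σ n, L.Ep n) (h : x.1 = n),
      L.lp n (sigGet x n h) = L.LP x := by
    intro n x h; subst h; rfl
  refine ⟨
    { v := fun k n a b => L.sp n (sigGet (ep (p - k).toNat (k + n + 1 - q).toNat) n
        (by rw [lp]; omega))
      em := fun k n a b => sigGet (em (p - k).toNat (k + n + 1 - q).toNat) n
        (by rw [lm]; omega)
      ep := fun k n a b => sigGet (ep (p - k).toNat (k + n + 1 - q).toNat) n
        (by rw [lp]; omega)
      em_s := ?_
      em_t := ?_
      ep_s := fun _ _ _ _ => rfl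
      ep_t := ?_
      label := ?_ }, ?_, ?_⟩
  · intro k n a b
    apply sig_inj
    rw [sm, sp, G.em_s]
    congr 2 <;> omega
  · intro k n a b
    apply sig_inj
    rw [tm, sp, G.em_t]
  · intro k n a b
    apply sig_inj
    rw [tp, sp, G.ep_t]
    congr 2; omega
  · refine ⟨fun k => if k ≤ p then L.LM (em (p - k).toNat 0) else L.LP (ep 0 (k - q).toNat),
      ?_, ?_⟩
    · intro k n a b
      rw [lam, am]
      exact (if_pos a).symm
    · intro k n a b
      rw [lap, ap]
      exact (if_neg (by omega)).symm
  · funext i j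
    simp only [Rect.gem]
    rw [sigGet_eq]
    congr 1 <;> omega
  · funext i j
    simp only [Rect.gep]
    rw [sigGet_eq]
    congr 1 <;> omega

theorem Zigzag.ext_sig {L : LambdaGraphBisystem A} {n₀ : ℕ} {v : L.V n₀} (a b : Zigzag L n₀ v)
    (h1 : ∀ k, a.ep k = b.ep k) (h2 : ∀ k, a.em k = b.em k) : a = b := by
  obtain ⟨e, f, _, _, _⟩ := a
  obtain ⟨e', f', _, _, _⟩ := b
  obtain rfl : e = e' := funext h1
  obtain rfl : f = f' := funext h2
  rfl

theorem Zigzag.cast_ep {L : LambdaGraphBisystem A} {n₀ : ℕ} {v w : L.V n₀} (h : v = w)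
    (a : Zigzag L n₀ v) : (h ▸ a : Zigzag L n₀ w).ep = a.ep := by subst h; rfl

theorem Zigzag.cast_em {L : LambdaGraphBisystem A} {n₀ : ℕ} {v w : L.V n₀} (h : v = w)
    (a : Zigzag L n₀ v) : (h ▸ a : Zigzag L n₀ w).em = a.em := by subst h; rfl

/-- Every zigzag path starting from a vertex `v ∈ V_{(p,q)}` extends in a
unique way to a `(p,q)`-rectangle whose upper left corner is `v`; restriction of
rectangles to zigzag paths is a bijective correspondence. -/
theorem zigzag_rectangle_bijection {A : Type} [Fintype A]
    (L : LambdaGraphBisystem A) (hL : IsLGBS L)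
    (p q : ℤ) (n₀ : ℕ) (hn : (n₀ : ℤ) = q - p - 1) (v : L.V n₀) :
    Function.Bijective (fun R : {R : Rect L p q // R.corner n₀ hn = v} =>
      (R.prop ▸ R.val.toZigzag n₀ hn : Zigzag L n₀ v)) := by
  have dp : ∀ (R : Rect L p q) (k : ℕ), R.gep n₀ hn k k = ⟨_, (R.toZigzag n₀ hn).ep k⟩ :=
    fun R k => R.epsig rfl (by omega)
  have dm : ∀ (R : Rect L p q) (k : ℕ), R.gem n₀ hn k (k + 1) = ⟨_, (R.toZigzag n₀ hn).em k⟩ :=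
    fun R k => R.emsig rfl (by omega)
  constructor
  · rintro ⟨R, hR⟩ ⟨S, hS⟩ h
    have h1 : (R.toZigzag n₀ hn).ep = (S.toZigzag n₀ hn).ep := by
      have := congrArg Zigzag.ep h
      dsimp only at this
      rwa [Zigzag.cast_ep, Zigzag.cast_ep] at this
    have h2 : (R.toZigzag n₀ hn).em = (S.toZigzag n₀ hn).em := by
      have := congrArg Zigzag.em h
      dsimp only at this
      rwa [Zigzag.cast_em, Zigzag.cast_em] at this
    obtain ⟨u1, u2⟩ := gridOK_unique (total_right hL) (total_left hL)
      (R.gridOK n₀ hn) (S.gridOK n₀ hn) (fun k => by rw [dp, dp, h1])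
      (fun k => by rw [dm, dm, h2])
    exact Subtype.ext (Rect.ext_of_grid R S n₀ hn u1 u2)
  · intro γ
    obtain ⟨em, ep, G, g1, g2⟩ := gridOK_exists (total_low hL) (total_up hL)
      (fun k => ((⟨n₀ + 2 * k, γ.ep k⟩ : Σ n, L.Ep n),
        (⟨n₀ + 2 * k + 1, γ.em k⟩ : Σ n, L.Em n)))
      (fun k => congrArg (Sigma.mk _) (γ.turn1 k)) (fun k => congrArg (Sigma.mk _) (γ.turn2 k))
    obtain ⟨R, r1, r2⟩ := Rect.exists_of_grid (p := p) n₀ hn em ep G (by rw [g1]; rfl)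
    have hp : ∀ k, (R.toZigzag n₀ hn).ep k = γ.ep k := fun k =>
      sig_inj (by rw [← dp, r2, g1])
    have hm : ∀ k, (R.toZigzag n₀ hn).em k = γ.em k := fun k =>
      sig_inj (by rw [← dm, r1, g2])
    have hc : R.corner n₀ hn = v := by
      have a := (R.toZigzag n₀ hn).start
      rw [hp] at a
      exact a.symm.trans γ.start
    refine ⟨⟨R, hc⟩, ?_⟩
    apply Zigzag.ext_sig
    · intro k
      dsimp only
      rw [Zigzag.cast_ep, hp]
    · intro k
      dsimp only
      rw [Zigzag.cast_em, hm]
end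

section
/- Let L be a λ-graph bisystem over a finite alphabet Σ satisfying FPCC. Every element (x₀, γ) of Z_L (a zigzag path γ starting from a vertex of V_1 together with a head symbol x₀) extends uniquely to a whole configuration on {(k,l) ∈ ℤ² : k < l}; consequently there is a bijective correspondence between Z_L and the configuration space X_L. -/
variable {A : Type}

/-! ## Helpers for the proof -/

namespace ZZProof

variable {L : LambdaGraphBisystem A}

def word (xs : ℤ → A) (k : ℤ) (n : ℕ) : List A :=
  (List.range n).map (fun i : ℕ => xs (k + 1 + i))

theorem word_snoc (xs : ℤ → A) (k : ℤ) (n : ℕ) :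
    word xs k (n + 1) = word xs k n ++ [xs (k + n + 1)] := by
  simp only [word, List.range_succ, List.map_append, List.map_cons, List.map_nil]
  rw [show k + 1 + (n : ℤ) = k + n + 1 by ring]

theorem word_cons (xs : ℤ → A) (k : ℤ) (n : ℕ) :
    word xs k (n + 1) = xs (k + 1) :: word xs (k + 1) n := by
  simp only [word, List.range_succ_eq_map, List.map_cons, List.map_map]
  congr 1
  · simp
  · apply List.map_congr_left
    intro i _
    simp only [Function.comp]
    congr 1
    push_cast
    ring

def Cons (L : LambdaGraphBisystem A) (xs : ℤ → A) (lo hi : ℤ) (f : ℤ → ∀ n : ℕ, L.V n) : Prop :=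
  (∀ (k : ℤ) (n : ℕ), lo ≤ k → k + n + 1 ≤ hi →
    ∃ e : L.Ep n, L.sp n e = f k n ∧ L.tp n e = f k (n + 1) ∧ L.lp n e = xs (k + n + 1)) ∧
  (∀ (k : ℤ) (n : ℕ), lo + 1 ≤ k → k + n ≤ hi →
    ∃ e : L.Em n, L.sm n e = f (k - 1) (n + 1) ∧ L.tm n e = f k n ∧ L.lm n e = xs k)

theorem Cons.mono {xs : ℤ → A} {lo hi lo' hi' : ℤ} {f : ℤ → ∀ n : ℕ, L.V n}
    (h : Cons L xs lo hi f) (h1 : lo ≤ lo') (h2 : hi' ≤ hi) : Cons L xs lo' hi' f :=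
  ⟨fun k n a b => h.1 k n (by omega) (by omega), fun k n a b => h.2 k n (by omega) (by omega)⟩

theorem cons_unique (hL : IsLGBS L) {xs : ℤ → A} {lo hi : ℤ} {f g : ℤ → ∀ n : ℕ, L.V n}
    (hf : Cons L xs lo hi f) (hg : Cons L xs lo hi g) (N : ℕ) (hN : lo + N = hi)
    (h : f lo N = g lo N) (k : ℤ) (n : ℕ) (h1 : lo ≤ k) (h2 : k + n ≤ hi) : f k n = g k n := by
  have key : ∀ s : ℕ, ∀ (k : ℤ) (n : ℕ), lo ≤ k → k + n ≤ hi → n + s = N → f k n = g k n := by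
    intro s
    induction s with
    | zero =>
      intro k n a b c
      obtain rfl : n = N := by omega
      obtain rfl : k = lo := by omega
      exact h
    | succ s ih =>
      intro k n a b c
      by_cases hk : k + n + 1 ≤ hi
      · obtain ⟨e, e1, e2, e3⟩ := hf.1 k n a hk
        obtain ⟨e', e1', e2', e3'⟩ := hg.1 k n a hk
        have := ih k (n + 1) a (by push_cast; omega) (by omega)
        have : e = e' := hL.leftResolving n e e' (by rw [e2, e2', this]) (by rw [e3, e3'])
        rw [← e1, ← e1', this]
      · obtain ⟨e, e1, e2, e3⟩ := hf.2 k n (by omega) b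
        obtain ⟨e', e1', e2', e3'⟩ := hg.2 k n (by omega) b
        have := ih (k - 1) (n + 1) (by omega) (by push_cast; omega) (by omega)
        have : e = e' := hL.rightResolving n e e' (by rw [e1, e1', this]) (by rw [e3, e3'])
        rw [← e2, ← e2', this]
  exact key (N - n) k n h1 h2 (by omega)

theorem ep_of_word {xs : ℤ → A} {k : ℤ} {n : ℕ} {v : L.V (n + 1)}
    (h : word xs k (n + 1) ∈ L.Pset (n + 1) v) :
    ∃ e : L.Ep n, L.tp n e = v ∧ L.lp n e = xs (k + n + 1) ∧ word xs k n ∈ L.Pset n (L.sp n e) := by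
  obtain ⟨e, he, w', hw', hw⟩ := h
  rw [word_snoc] at hw
  have := List.append_inj' hw rfl
  refine ⟨e, he, ?_, ?_⟩
  · simpa using this.2.symm
  · rw [this.1]; exact hw'

theorem em_of_word (hL : IsLGBS L) {xs : ℤ → A} {k : ℤ} {n : ℕ} {v : L.V (n + 1)}
    (h : word xs k (n + 1) ∈ L.Pset (n + 1) v) :
    ∃ e : L.Em n, L.sm n e = v ∧ L.lm n e = xs (k + 1) ∧
      word xs (k + 1) n ∈ L.Pset n (L.tm n e) := by
  rw [← hL.fpcc] at h
  obtain ⟨e, he, w', hw', hw⟩ := h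
  rw [word_cons] at hw
  injection hw with h1 h2
  refine ⟨e, he, h1.symm, ?_⟩
  rw [← hL.fpcc, h2]; exact hw'

theorem cons_exists (hL : IsLGBS L) (xs : ℤ → A) : ∀ (N : ℕ) (k : ℤ) (v : L.V N),
    word xs k N ∈ L.Pset N v → ∃ f, Cons L xs k (k + N) f ∧ f k N = v := by
  intro N
  induction N with
  | zero =>
    intro k v _
    have := hL.subsingletonV0
    refine ⟨fun _ n => (L.nonemptyV n).some, ⟨fun k' n a b => ?_, fun k' n a b => ?_⟩,
      Subsingleton.elim _ _⟩
    · push_cast at b; omega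
    · push_cast at b; omega
  | succ N ih =>
    intro k v hv
    obtain ⟨e, he, hel, hew⟩ := ep_of_word hv
    obtain ⟨g, hg, hgl, hgw⟩ := em_of_word hL hv
    obtain ⟨f1, c1, a1⟩ := ih k _ hew
    obtain ⟨f2, c2, a2⟩ := ih (k + 1) _ hgw
    have agree : ∀ (k' : ℤ) (n : ℕ), k + 1 ≤ k' → k' + n ≤ k + N → f1 k' n = f2 k' n := by
      intro k' n h1 h2
      obtain _ | M := N
      · push_cast at h2; omega
      refine cons_unique hL (c1.mono (lo' := k + 1) (by omega) le_rfl)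
        (c2.mono (hi' := k + (M + 1 : ℕ)) le_rfl (by omega)) M (by push_cast; omega) ?_ k' n h1 h2
      obtain ⟨a, as, at', al⟩ := c1.2 (k + 1) M (by omega) (by push_cast; omega)
      obtain ⟨φ, hφ⟩ := hL.localProperty M (L.tm M a) v
      have as' : L.sm M a = L.sp (M + 1) e := by
        rw [as, ← a1]; congr 1; omega
      have h3 := hφ (φ.symm ⟨(a, e), rfl, as', he⟩)
      rw [Equiv.apply_symm_apply] at h3
      generalize φ.symm ⟨(a, e), rfl, as', he⟩ = pq at h3
      obtain ⟨⟨p, q⟩, hp, hpq, hq⟩ := pq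
      simp only at h3 hp hpq hq
      have hqg : q = g := hL.rightResolving _ _ _ (by rw [hq, hg]) (by rw [h3.2, hgl, al])
      subst hqg
      obtain ⟨b, bs, bt, bl⟩ := c2.1 (k + 1) M le_rfl (by push_cast; omega)
      have hbp : b = p := hL.leftResolving _ _ _ (by rw [bt, hpq, a2])
        (by rw [bl, h3.1, hel]; congr 1; push_cast; ring)
      rw [← bs, hbp, hp, at']
    refine ⟨fun k' => if k' = k then Function.update (f1 k) (N + 1) v else f2 k',
      ⟨fun k' n a b => ?_, fun k' n a b => ?_⟩, by simp⟩
    · by_cases hk : k' = k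
      · subst hk
        simp only [if_true]
        by_cases hn : n = N
        · subst hn
          refine ⟨e, ?_, ?_, hel⟩
          · rw [Function.update_of_ne (by omega), a1]
          · simp [he]
        · rw [Function.update_of_ne (by push_cast at b; omega),
            Function.update_of_ne (by omega)]
          exact c1.1 _ _ le_rfl (by push_cast at b; omega)
      · simp only [hk, if_false]
        exact c2.1 _ _ (by omega) (by push_cast at b; omega)
    · have hk : k' ≠ k := by omega
      simp only [hk, if_false]
      by_cases hk1 : k' - 1 = k
      · obtain rfl : k' = k + 1 := by omega
        simp only [hk1, if_true]
        by_cases hn : n = N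
        · subst hn
          exact ⟨g, by simp [hg], a2.symm, hgl⟩
        · rw [Function.update_of_ne (by omega)]
          obtain ⟨a', b1, b2, b3⟩ := c1.2 (k + 1) n (by omega) (by push_cast at b; omega)
          refine ⟨a', ?_, ?_, b3⟩
          · rw [b1, hk1]
          · rw [b2, agree _ _ le_rfl (by push_cast at b; omega)]
      · simp only [hk1, if_false]
        exact c2.2 _ _ (by omega) (by push_cast at b; omega)

theorem zh_ext (z w : ZigzagHead L) (h0 : z.x0 = w.x0) (h1 : ∀ k, z.γ.ep k = w.γ.ep k)
    (h2 : ∀ k, z.γ.em k = w.γ.em k) : z = w := by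
  obtain ⟨x, v, ⟨ep, em, st, t1, t2⟩, hd⟩ := z
  obtain ⟨x', v', ⟨ep', em', st', t1', t2'⟩, hd'⟩ := w
  simp only at h0 h1 h2
  obtain rfl : ep = ep' := funext h1
  obtain rfl : em = em' := funext h2
  subst h0
  subst st
  subst st'
  rfl

theorem config_ext (x y : Config L) (h0 : x.v = y.v) (h1 : x.em = y.em) (h2 : x.ep = y.ep) :
    x = y := by
  cases x; cases y; simp only at h0 h1 h2; subst h0 h1 h2; rfl

theorem config_cons (x : Config L) (xs : ℤ → A)
    (h1 : ∀ (k : ℤ) (n : ℕ), L.lm n (x.em k n) = xs k)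
    (h2 : ∀ (k : ℤ) (n : ℕ), L.lp n (x.ep k n) = xs (k + n + 1)) (lo hi : ℤ) :
    Cons L xs lo hi x.v :=
  ⟨fun k n _ _ => ⟨_, x.ep_s k n, x.ep_t k n, h2 k n⟩,
   fun k n _ _ => ⟨_, x.em_s k n, x.em_t k n, h1 k n⟩⟩

theorem inj (hL : IsLGBS L) : Function.Injective (fun x : Config L => x.toZigzagHead) := by
  intro x y h
  simp only at h
  have h0 : L.lp 0 (x.ep (-1) 0) = L.lp 0 (y.ep (-1) 0) := congrArg (fun z => z.x0) h
  have hp : ∀ k : ℕ, x.ep (-1 - (k : ℤ)) (1 + 2 * k) = y.ep (-1 - (k : ℤ)) (1 + 2 * k) :=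
    fun k => congrArg (fun z => z.γ.ep k) h
  have hm : ∀ k : ℕ, x.em (-1 - (k : ℤ)) (1 + 2 * k + 1) = y.em (-1 - (k : ℤ)) (1 + 2 * k + 1) :=
    fun k => congrArg (fun z => z.γ.em k) h
  obtain ⟨xs, x1, x2⟩ := x.label
  obtain ⟨ys, y1, y2⟩ := y.label
  have hxy : xs = ys := by
    funext j
    rcases lt_trichotomy j 0 with hj | hj | hj
    · obtain ⟨m, rfl⟩ : ∃ m : ℕ, j = -1 - (m : ℤ) := ⟨(-1 - j).toNat, by omega⟩
      rw [← x1 _ (1 + 2 * m + 1), hm, y1]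
    · subst hj
      rw [x2, y2] at h0
      simpa using h0
    · obtain ⟨m, rfl⟩ : ∃ m : ℕ, j = m + 1 := ⟨(j - 1).toNat, by omega⟩
      have := congrArg (L.lp _) (hp m)
      rw [x2, y2] at this
      convert this using 2 <;> (push_cast; ring)
  subst hxy
  have hv : ∀ k n, x.v k n = y.v k n := by
    intro k n
    obtain ⟨m, hm⟩ : ∃ m : ℕ, m = k.natAbs + n := ⟨_, rfl⟩
    refine cons_unique hL (config_cons x xs x1 x2 (-1 - (m : ℤ)) (m + 1))
      (config_cons y xs y1 y2 (-1 - (m : ℤ)) (m + 1)) (1 + 2 * m + 1) (by push_cast; ring) ?_ k n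
      (by omega) (by omega)
    rw [← x.ep_t, ← y.ep_t, hp]
  refine config_ext x y (by funext k n; exact hv k n) ?_ ?_
  · funext k n
    exact hL.rightResolving _ _ _ (by rw [x.em_s, y.em_s, hv]) (by rw [x1, y1])
  · funext k n
    exact hL.leftResolving _ _ _ (by rw [x.ep_t, y.ep_t, hv]) (by rw [x2, y2])

def zseq (z : ZigzagHead L) : ℤ → A
  | Int.ofNat 0 => z.x0
  | Int.ofNat (m + 1) => L.lp _ (z.γ.ep m)
  | Int.negSucc m => L.lm _ (z.γ.em m)

theorem zseq_zero (z : ZigzagHead L) : zseq z 0 = z.x0 := rfl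

theorem zseq_pos (z : ZigzagHead L) (m : ℕ) : zseq z ((m : ℤ) + 1) = L.lp _ (z.γ.ep m) := rfl

theorem zseq_neg (z : ZigzagHead L) (m : ℕ) : zseq z (-1 - (m : ℤ)) = L.lm _ (z.γ.em m) := by
  rw [show -1 - (m : ℤ) = Int.negSucc m by omega]; rfl

theorem word_step (z : ZigzagHead L) (m : ℕ)
    (h : word (zseq z) (-1 - (m : ℤ)) (1 + 2 * m) ∈ L.Pset _ (L.sp _ (z.γ.ep m))) :
    word (zseq z) (-1 - (m : ℤ)) (1 + 2 * m + 1) ∈ L.Pset _ (L.tp _ (z.γ.ep m)) := by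
  refine ⟨z.γ.ep m, rfl, _, h, ?_⟩
  rw [word_snoc, ← zseq_pos]
  congr 3
  push_cast; ring

theorem word_mem (hL : IsLGBS L) (z : ZigzagHead L) (m : ℕ) :
    word (zseq z) (-1 - (m : ℤ)) (1 + 2 * m) ∈ L.Pset _ (L.sp _ (z.γ.ep m)) := by
  induction m with
  | zero =>
    obtain ⟨e, he, ht⟩ := z.head
    refine ⟨e, ?_, [], rfl, ?_⟩
    · rw [ht]; exact z.γ.start.symm
    · rw [he, ← zseq_zero]; simp [word]
  | succ m ih =>
    have h := word_step z m ih
    rw [← hL.fpcc, z.γ.turn1] at h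
    have h2 : word (zseq z) (-1 - ((m + 1 : ℕ) : ℤ)) (1 + 2 * m + 1 + 1) ∈
        L.Fset (1 + 2 * m + 1 + 1) (L.sm _ (z.γ.em m)) := by
      refine ⟨z.γ.em m, rfl, _, h, ?_⟩
      rw [word_cons, ← zseq_neg]
      congr 2 <;> (push_cast; ring)
    rw [hL.fpcc, z.γ.turn2] at h2
    exact h2

theorem surj (hL : IsLGBS L) : Function.Surjective (fun x : Config L => x.toZigzagHead) := by
  intro z
  have hex : ∀ m : ℕ, ∃ f, Cons L (zseq z) (-1 - (m : ℤ)) (m + 1) f ∧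
      f (-1 - (m : ℤ)) (1 + 2 * m + 1) = L.tp _ (z.γ.ep m) := by
    intro m
    obtain ⟨f, h1, h2⟩ := cons_exists hL (zseq z) _ _ _ (word_step z m (word_mem hL z m))
    exact ⟨f, h1.mono le_rfl (by push_cast; omega), h2⟩
  choose f hc ha using hex
  -- the vertex below the apex
  have hsp : ∀ m : ℕ, f m (-1 - (m : ℤ)) (1 + 2 * m) = L.sp _ (z.γ.ep m) := by
    intro m
    obtain ⟨e, e1, e2, e3⟩ := (hc m).1 (-1 - (m : ℤ)) (1 + 2 * m) le_rfl (by push_cast; omega)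
    have : e = z.γ.ep m := hL.leftResolving _ _ _ (by rw [e2, ha])
      (by rw [e3, ← zseq_pos]; congr 1; push_cast; ring)
    rw [← e1, this]
  have hsm : ∀ m : ℕ, f (m + 1) (-1 - (m : ℤ) - 1) (1 + 2 * m + 1 + 1) = L.sm _ (z.γ.em m) := by
    intro m
    rw [z.γ.turn2]
    rw [show -1 - (m : ℤ) - 1 = -1 - ((m + 1 : ℕ) : ℤ) by push_cast; ring]
    exact hsp (m + 1)
  have hstep0 : ∀ m : ℕ, f (m + 1) (-1 - (m : ℤ)) (1 + 2 * m + 1) = L.tp _ (z.γ.ep m) := by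
    intro m
    obtain ⟨e, e1, e2, e3⟩ := (hc (m + 1)).2 (-1 - (m : ℤ)) (1 + 2 * m + 1)
      (by push_cast; omega) (by push_cast; omega)
    have : e = z.γ.em m := hL.rightResolving _ _ _ (by rw [e1, hsm]) (by rw [e3, zseq_neg])
    rw [← e2, this, z.γ.turn1]
  have hstep : ∀ (m : ℕ) (k : ℤ) (n : ℕ), -1 - (m : ℤ) ≤ k → k + n ≤ m + 1 →
      f (m + 1) k n = f m k n := by
    intro m k n h1 h2
    refine cons_unique hL ((hc (m + 1)).mono (by push_cast; omega) (by push_cast; omega)) (hc m)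
      (1 + 2 * m + 1) (by push_cast; ring) ?_ k n h1 h2
    rw [hstep0, ha]
  have hadd : ∀ (d m : ℕ) (k : ℤ) (n : ℕ), -1 - (m : ℤ) ≤ k → k + n ≤ m + 1 →
      f (m + d) k n = f m k n := by
    intro d
    induction d with
    | zero => intros; rfl
    | succ d ih =>
      intro m k n h1 h2
      rw [← add_assoc, hstep _ _ _ (by push_cast; omega) (by push_cast; omega), ih m k n h1 h2]
  have hag : ∀ (m m' : ℕ) (k : ℤ) (n : ℕ), -1 - (m : ℤ) ≤ k → k + n ≤ m + 1 →
      -1 - (m' : ℤ) ≤ k → k + n ≤ m' + 1 → f m k n = f m' k n := by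
    intro m m' k n h1 h2 h3 h4
    rcases le_total m m' with h | h
    · obtain ⟨d, rfl⟩ := Nat.exists_eq_add_of_le h
      exact (hadd d m k n h1 h2).symm
    · obtain ⟨d, rfl⟩ := Nat.exists_eq_add_of_le h
      exact hadd d m' k n h3 h4
  obtain ⟨v, hv⟩ : ∃ v : ℤ → ∀ n : ℕ, L.V n, ∀ (m : ℕ) (k : ℤ) (n : ℕ), -1 - (m : ℤ) ≤ k →
      k + n ≤ m + 1 → f m k n = v k n :=
    ⟨fun k n => f (k.natAbs + n) k n, fun m k n h1 h2 =>
      hag _ _ _ _ h1 h2 (by omega) (by omega)⟩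
  have hep : ∀ (k : ℤ) (n : ℕ), ∃ e : L.Ep n, L.sp n e = v k n ∧ L.tp n e = v k (n + 1) ∧
      L.lp n e = zseq z (k + n + 1) := by
    intro k n
    obtain ⟨m, hm⟩ : ∃ m : ℕ, m = k.natAbs + n := ⟨_, rfl⟩
    rw [← hv m k n (by omega) (by omega), ← hv m k (n + 1) (by omega) (by push_cast; omega)]
    exact (hc m).1 k n (by omega) (by omega)
  have hem : ∀ (k : ℤ) (n : ℕ), ∃ e : L.Em n, L.sm n e = v (k - 1) (n + 1) ∧ L.tm n e = v k n ∧
      L.lm n e = zseq z k := by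
    intro k n
    obtain ⟨m, hm⟩ : ∃ m : ℕ, m = k.natAbs + n := ⟨_, rfl⟩
    rw [← hv m k n (by omega) (by omega), ← hv m (k - 1) (n + 1) (by omega) (by push_cast; omega)]
    exact (hc m).2 k n (by omega) (by omega)
  choose ep p1 p2 p3 using hep
  choose em m1 m2 m3 using hem
  refine ⟨⟨v, em, ep, m1, m2, p1, p2, zseq z, m3, p3⟩, ?_⟩
  apply zh_ext
  · change L.lp 0 (ep (-1) 0) = z.x0
    rw [p3, ← zseq_zero]
    rfl
  · intro k
    change ep (-1 - (k : ℤ)) (1 + 2 * k) = z.γ.ep k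
    refine hL.leftResolving _ _ _ ?_ ?_
    · rw [p2, ← hv k _ _ le_rfl (by push_cast; omega), ha]
    · rw [p3, ← zseq_pos]; congr 1; push_cast; ring
  · intro k
    change em (-1 - (k : ℤ)) (1 + 2 * k + 1) = z.γ.em k
    refine hL.rightResolving _ _ _ ?_ ?_
    · rw [m1, ← hv (k + 1) _ _ (by push_cast; omega) (by push_cast; omega), hsm]
    · rw [m3, zseq_neg]

end ZZProof

/-- Every element `(x₀, γ)` of `Z_L` extends uniquely to a whole
configuration; restriction of configurations to zigzag paths with head symbol is a
bijective correspondence between `X_L` and `Z_L`. -/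
theorem config_zigzagHead_bijection {A : Type} [Fintype A]
    (L : LambdaGraphBisystem A) (hL : IsLGBS L) :
    Function.Bijective (fun x : Config L => x.toZigzagHead) := by
  exact ⟨ZZProof.inj hL, ZZProof.surj hL⟩
end
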